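/- arXiv:1610.09888 — 4 statements merged into one kernel-verified Lean document; each statement's English description precedes it below -/
import Mathlib

section
/- Every finite connected simple graph admits a strong trace. -/
open SimpleGraph

/-- A closed walk is a *double trace* if it traverses every edge of the graph exactly twice. -/
def IsDoubleTrace {V : Type*} [DecidableEq V] {G : SimpleGraph V} {x : V} (w : G.Walk x x) : Prop :=
  ∀ e ∈ G.edgeSet, w.edges.count e = 2

/-- The number of times a walk traverses the edge between `a` and `b`
in the direction from `a` to `b`. -/
def traversals {V : Type*} [DecidableEq V] {G : SimpleGraph V} {x y : V} (w : G.Walk x y)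
    (a b : V) : ℕ :=
  (w.darts.map SimpleGraph.Dart.toProd).count (a, b)

/-- A closed walk `w` has an `N`-repetition at `v`: whenever `w` visits `v` (indices taken
cyclically), the predecessor vertex lies in `N` iff the successor vertex lies in `N`. -/
def HasRepetition {V : Type*} {G : SimpleGraph V} {x : V} (w : G.Walk x x) (v : V)
    (N : Set V) : Prop :=
  ∀ i < w.length, w.getVert i = v →
    ((w.getVert ((i + w.length - 1) % w.length) ∈ N) ↔ (w.getVert ((i + 1) % w.length) ∈ N))

/-- A *strong trace* is a double trace without nontrivial repetitions: there is no vertex `v`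
and set `N` of neighbours of `v`, nonempty and proper in `N(v)`, forming an `N`-repetition. -/
def IsStrongTrace {V : Type*} [DecidableEq V] {G : SimpleGraph V} {x : V} (w : G.Walk x x) : Prop :=
  IsDoubleTrace w ∧
    ∀ (v : V) (N : Set V), N ⊆ G.neighborSet v → N.Nonempty → N ≠ G.neighborSet v →
      ¬ HasRepetition w v N

/-- A *`d`-stable trace* is a double trace without `N`-repetitions for sets `N` of neighbours
with `1 ≤ |N| ≤ d`. -/
def IsStableTrace {V : Type*} [DecidableEq V] {G : SimpleGraph V} (d : ℕ) {x : V}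
    (w : G.Walk x x) : Prop :=
  IsDoubleTrace w ∧
    ∀ (v : V) (N : Set V), N ⊆ G.neighborSet v → 1 ≤ N.ncard → N.ncard ≤ d →
      ¬ HasRepetition w v N

/-- A closed walk is *antiparallel* if it traverses every edge once in each direction. -/
def IsAntiparallel {V : Type*} [DecidableEq V] {G : SimpleGraph V} {x : V}
    (w : G.Walk x x) : Prop :=
  ∀ a b, G.Adj a b → traversals w a b = 1 ∧ traversals w b a = 1

/-- A closed walk is *parallel* if it traverses every edge twice in the same direction. -/
def IsParallel {V : Type*} [DecidableEq V] {G : SimpleGraph V} {x : V}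
    (w : G.Walk x x) : Prop :=
  ∀ a b, G.Adj a b →
    (traversals w a b = 2 ∧ traversals w b a = 0) ∨
      (traversals w a b = 0 ∧ traversals w b a = 2)

/-- `T` is a spanning tree of `G`: a connected acyclic spanning subgraph. -/
def IsSpanningTree {V : Type*} (G T : SimpleGraph V) : Prop :=
  T ≤ G ∧ T.Connected ∧ T.IsAcyclic

/-- The number of edges of `H` lying in the connected component `C` of `H`. -/
noncomputable def componentEdgeCount {V : Type*} (H : SimpleGraph V)
    (C : H.ConnectedComponent) : ℕ :=
  {e : Sym2 V | e ∈ H.edgeSet ∧ ∀ a ∈ e, a ∈ C.supp}.ncard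

namespace ST
variable {V : Type*} {G : SimpleGraph V}

/-- inner repetition condition of an open walk -/
def R {x y : V} (w : G.Walk x y) (z : V) (N : Set V) : Prop :=
  ∀ i, i + 2 ≤ w.length → w.getVert (i+1) = z → (w.getVert i ∈ N ↔ w.getVert (i+2) ∈ N)

def C {x : V} (w : G.Walk x x) (z : V) (N : Set V) : Prop :=
  R w z N ∧ (x = z → (w.penultimate ∈ N ↔ w.snd ∈ N))

theorem R_append {x y t : V} (p : G.Walk x y) (q : G.Walk y t) (hp : ¬ p.Nil) (hq : ¬ q.Nil)
    (z : V) (N : Set V) :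
    R (p.append q) z N ↔ R p z N ∧ R q z N ∧ (y = z → (p.penultimate ∈ N ↔ q.snd ∈ N)) := by
  have lp : 0 < p.length := by
    rw [Nat.pos_iff_ne_zero]; intro h; exact hp (Walk.nil_iff_length_eq.2 h)
  have lq : 0 < q.length := by
    rw [Nat.pos_iff_ne_zero]; intro h; exact hq (Walk.nil_iff_length_eq.2 h)
  have key1 : ∀ i, i ≤ p.length → (p.append q).getVert i = p.getVert i := by
    intro i hi
    rw [Walk.getVert_append]
    split_ifs with h
    · rfl
    · have : i = p.length := by omega
      subst this; simp
  have key2 : ∀ i, (p.append q).getVert (p.length + i) = q.getVert i := by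
    intro i
    rw [Walk.getVert_append]
    simp
  constructor
  · intro h
    refine ⟨?_, ?_, ?_⟩
    · intro i hi hz
      have := h i (by simp; omega) (by rw [key1 _ (by omega)]; exact hz)
      rwa [key1 _ (by omega), key1 _ (by omega)] at this
    · intro i hi hz
      have := h (p.length + i) (by simp; omega) (by rw [add_assoc, key2]; exact hz)
      rwa [key2, add_assoc, key2] at this
    · intro hz
      have := h (p.length - 1) (by simp; omega)
        (by rw [key1 _ (by omega), Nat.sub_add_cancel lp]; simpa using hz)
      rw [key1 _ (by omega), show p.length - 1 + 2 = p.length + 1 by omega, key2] at this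
      exact this
  · rintro ⟨h1, h2, h3⟩ i hi hz
    rw [Walk.length_append] at hi
    rcases lt_trichotomy (i+1) p.length with h | h | h
    · rw [key1 _ (by omega)] at hz
      rw [key1 _ (by omega), key1 _ (by omega)]
      exact h1 i (by omega) hz
    · rw [key1 _ (by omega), h, Walk.getVert_length] at hz
      rw [key1 _ (by omega), show i + 2 = p.length + 1 by omega, key2,
        show i = p.length - 1 by omega]
      exact h3 hz
    · obtain ⟨j, rfl⟩ : ∃ j, i = p.length + j := ⟨i - p.length, by omega⟩
      rw [add_assoc, key2] at hz
      rw [key2, add_assoc, key2]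
      exact h2 j (by omega) hz

theorem R_reverse {x y : V} (p : G.Walk x y) (z : V) (N : Set V) (h : R p.reverse z N) :
    R p z N := by
  intro i hi hz
  have := h (p.length - (i+2)) (by simp; omega)
    (by rw [Walk.getVert_reverse, show p.length - (p.length - (i+2) + 1) = i + 1 by omega]; exact hz)
  rw [Walk.getVert_reverse, Walk.getVert_reverse,
    show p.length - (p.length - (i+2)) = i + 2 by omega,
    show p.length - (p.length - (i+2) + 2) = i by omega] at this
  exact this.symm

theorem snd_append {x y t : V} (p : G.Walk x y) (q : G.Walk y t) (hp : ¬ p.Nil) :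
    (p.append q).snd = p.snd := by
  cases p with
  | nil => simp at hp
  | cons h p => simp

theorem pen_append {x y t : V} (p : G.Walk x y) (q : G.Walk y t) (hq : ¬ q.Nil) :
    (p.append q).penultimate = q.penultimate := by
  rw [← Walk.snd_reverse, Walk.reverse_append, snd_append _ _ (by simpa using hq), Walk.snd_reverse]

theorem C_append {x y : V} (p : G.Walk x y) (q : G.Walk y x) (hp : ¬ p.Nil) (hq : ¬ q.Nil)
    (z : V) (N : Set V) :
    C (p.append q) z N ↔ R p z N ∧ R q z N ∧ (y = z → (p.penultimate ∈ N ↔ q.snd ∈ N)) ∧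
      (x = z → (q.penultimate ∈ N ↔ p.snd ∈ N)) := by
  unfold C
  rw [R_append p q hp hq, snd_append _ _ hp, pen_append _ _ hq]
  tauto

variable [DecidableEq V]

def Good {x : V} (w : G.Walk x x) : Prop :=
  (∀ e ∈ w.edges, w.edges.count e = 2) ∧
  ∀ z N, C w z N → ∀ a b, s(z,a) ∈ w.edges → s(z,b) ∈ w.edges → (a ∈ N ↔ b ∈ N)

theorem rot {x u : V} (w : G.Walk x x) (hw : Good w) (hu : u ∈ w.support) :
    ∃ w' : G.Walk u u, Good w' ∧ w'.edges.Perm w.edges := by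
  obtain ⟨p, q, rfl⟩ : ∃ (p : G.Walk x u) (q : G.Walk u x), w = p.append q :=
    ⟨w.takeUntil u hu, w.dropUntil u hu, (w.take_spec hu).symm⟩
  have hperm : (q.append p).edges.Perm (p.append q).edges := by
    simp only [Walk.edges_append]; exact List.perm_append_comm
  by_cases hp : p.Nil
  · cases hp
    exact ⟨q, by simpa using hw, by simp⟩
  by_cases hq : q.Nil
  · cases hq
    exact ⟨p, by simpa using hw, by simp⟩
  refine ⟨q.append p, ⟨?_, ?_⟩, hperm⟩
  · intro e he
    rw [hperm.count_eq]; exact hw.1 e (hperm.mem_iff.1 he)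
  · intro z N hC a b ha hb
    rw [hperm.mem_iff] at ha hb
    refine hw.2 z N ?_ a b ha hb
    rw [C_append _ _ hp hq]
    rw [C_append _ _ hq hp] at hC
    tauto

theorem R_one {x y : V} (h : G.Adj x y) (z : V) (N : Set V) : R (Walk.cons h Walk.nil) z N := by
  intro i hi; simp at hi

theorem count_step {x u v : V} {w : G.Walk x x} {w' : G.Walk u u} (hw : Good w)
    (hn : s(u,v) ∉ w.edges) (hp : w'.edges.Perm (s(u,v) :: s(u,v) :: w.edges)) :
    ∀ e ∈ w'.edges, w'.edges.count e = 2 := by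
  intro e he
  rw [hp.count_eq]
  by_cases h : e = s(u,v)
  · subst h
    simp [List.count_eq_zero_of_not_mem hn]
  · rw [hp.mem_iff] at he
    simp only [List.mem_cons, h, false_or] at he
    rw [List.count_cons_of_ne (Ne.symm h), List.count_cons_of_ne (Ne.symm h)]
    exact hw.1 e he

theorem start_mem {x y : V} (p : G.Walk x y) (hp : ¬ p.Nil) : s(x, p.snd) ∈ p.edges :=
  Walk.mk_start_snd_mem_edges hp

theorem ext1 {u v : V} (w : G.Walk u u) (hw : Good w) (huv : G.Adj u v) (hv : v ∉ w.support) :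
    ∃ w' : G.Walk u u, Good w' ∧ w'.edges.Perm (s(u,v) :: s(u,v) :: w.edges) := by
  have hn : s(u,v) ∉ w.edges := fun h => hv (w.snd_mem_support_of_mem_edges h)
  let E := Walk.cons huv (Walk.cons huv.symm Walk.nil)
  have hE : ¬ E.Nil := by simp [E]
  have hp : (w.append E).edges.Perm (s(u,v) :: s(u,v) :: w.edges) := by
    rw [Walk.edges_append]
    refine List.perm_append_comm.trans ?_
    simp [E, Sym2.eq_swap]
  refine ⟨w.append E, ⟨count_step hw hn hp, ?_⟩, hp⟩
  intro z N hC
  suffices ∃ T : Prop, ∀ a, s(z,a) ∈ (w.append E).edges → (a ∈ N ↔ T) by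
    obtain ⟨T, hT⟩ := this
    intro a b ha hb
    rw [hT a ha, hT b hb]
  simp only [hp.mem_iff, List.mem_cons]
  have hne := huv.ne
  by_cases hzv : z = v
  · subst hzv
    refine ⟨u ∈ N, ?_⟩
    intro a ha
    have : ¬ s(z,a) ∈ w.edges := fun h => hv (w.fst_mem_support_of_mem_edges h)
    have : a = u := by
      simp only [this, or_false, or_self, Sym2.eq_iff] at ha
      grind
    rw [this]
  by_cases hnil : w.Nil
  · refine ⟨v ∈ N, ?_⟩
    intro a ha
    have : w.edges = [] := by cases hnil; rfl
    rw [this] at ha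
    simp only [List.not_mem_nil, or_false, or_self, Sym2.eq_iff] at ha
    have : a = v := by grind
    rw [this]
  rw [C_append _ _ hnil hE] at hC
  obtain ⟨h1, -, h2, h3⟩ := hC
  have e1 : E.snd = v := by simp [E]
  have e2 : E.penultimate = v := by simp [E]
  rw [e1] at h2
  rw [e2] at h3
  have hC : C w z N := ⟨h1, fun h => (h2 h).trans (h3 h)⟩
  have H := hw.2 z N hC
  by_cases hzu : z = u
  · subst hzu
    refine ⟨v ∈ N, ?_⟩
    intro a ha
    by_cases hav : a = v
    · rw [hav]
    · have ha : s(z,a) ∈ w.edges := by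
        simp only [Sym2.eq_iff] at ha; grind
      rw [H a w.snd ha (start_mem w hnil)]
      exact (h3 rfl).symm
  · by_cases hex : ∃ b, s(z,b) ∈ w.edges
    · obtain ⟨b, hb⟩ := hex
      refine ⟨b ∈ N, ?_⟩
      intro a ha
      refine H a b ?_ hb
      simp only [Sym2.eq_iff] at ha; grind
    · refine ⟨True, fun a ha => absurd ⟨a, ?_⟩ hex⟩
      simp only [Sym2.eq_iff] at ha; grind

theorem ext2 {u v : V} (w : G.Walk u u) (hw : Good w) (huv : G.Adj u v) (hv : v ∈ w.support)
    (hn : s(u,v) ∉ w.edges) :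
    ∃ w' : G.Walk u u, Good w' ∧ w'.edges.Perm (s(u,v) :: s(u,v) :: w.edges) := by
  obtain ⟨P, Q, rfl⟩ : ∃ (p : G.Walk u v) (q : G.Walk v u), w = p.append q :=
    ⟨w.takeUntil v hv, w.dropUntil v hv, (w.take_spec hv).symm⟩
  have hne := huv.ne
  have hP : ¬ P.Nil := Walk.not_nil_of_ne hne
  have hQ : ¬ Q.Nil := Walk.not_nil_of_ne hne.symm
  have hQr : ¬ Q.reverse.Nil := Walk.not_nil_of_ne hne
  let E := Walk.cons huv.symm Walk.nil
  have hE : ¬ E.Nil := by simp [E]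
  have e1 : E.snd = u := by simp [E]
  have e2 : E.penultimate = v := by simp [E]
  let A := P.append E
  let B := Q.reverse.append E
  have hA : ¬ A.Nil := by simp [A, hP]
  have hB : ¬ B.Nil := by simp [B, hQ]
  have hp : (A.append B).edges.Perm (s(u,v) :: s(u,v) :: (P.append Q).edges) := by
    have : E.edges = [s(u,v)] := by simp [E, Sym2.eq_swap]
    simp only [A, B, Walk.edges_append, this, Walk.edges_reverse]
    have := List.reverse_perm Q.edges
    rw [List.perm_iff_count] at this ⊢
    intro a
    simp only [List.count_append, List.count_cons, this, List.count_nil]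
    omega
  refine ⟨A.append B, ⟨count_step hw hn hp, ?_⟩, hp⟩
  intro z N hC
  rw [C_append _ _ hA hB, R_append _ _ hP hE, R_append _ _ hQr hE] at hC
  simp only [A, B, pen_append _ _ hE, snd_append _ _ hP, snd_append _ _ hQr, e1, e2,
    Walk.snd_reverse, Walk.penultimate_reverse] at hC
  obtain ⟨⟨r1, -, c1⟩, ⟨r2, -, c2⟩, c3, c4⟩ := hC
  have hC : C (P.append Q) z N := by
    rw [C_append _ _ hP hQ]
    refine ⟨r1, R_reverse _ _ _ r2, ?_, ?_⟩ <;> tauto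
  have H := hw.2 z N hC
  suffices ∃ T : Prop, ∀ a, s(z,a) ∈ (A.append B).edges → (a ∈ N ↔ T) by
    obtain ⟨T, hT⟩ := this
    intro a b ha hb
    rw [hT a ha, hT b hb]
  simp only [hp.mem_iff, List.mem_cons]
  by_cases hzu : z = u
  · subst hzu
    refine ⟨v ∈ N, ?_⟩
    intro a ha
    by_cases hav : a = v
    · rw [hav]
    · have ha : s(z,a) ∈ (P.append Q).edges := by
        simp only [Sym2.eq_iff] at ha; grind
      rw [H a P.snd ha (by rw [Walk.edges_append]; exact List.mem_append_left _ (start_mem P hP))]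
      exact (c4 rfl).symm
  by_cases hzv : z = v
  · subst hzv
    refine ⟨u ∈ N, ?_⟩
    intro a ha
    by_cases hav : a = u
    · rw [hav]
    · have ha : s(z,a) ∈ (P.append Q).edges := by
        simp only [Sym2.eq_iff] at ha; grind
      rw [H a Q.snd ha (by rw [Walk.edges_append]; exact List.mem_append_right _ (start_mem Q hQ))]
      exact c2 rfl
  · by_cases hex : ∃ b, s(z,b) ∈ (P.append Q).edges
    · obtain ⟨b, hb⟩ := hex
      refine ⟨b ∈ N, ?_⟩
      intro a ha
      refine H a b ?_ hb
      simp only [Sym2.eq_iff] at ha; grind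
    · refine ⟨True, fun a ha => absurd ⟨a, ?_⟩ hex⟩
      simp only [Sym2.eq_iff] at ha; grind

theorem step (hG : G.Connected) {x : V} (w : G.Walk x x) (hw : Good w)
    (hex : ¬ ∀ e ∈ G.edgeSet, e ∈ w.edges) :
    ∃ (u : V) (w' : G.Walk u u), Good w' ∧ w'.length = w.length + 2 := by
  obtain ⟨u, v, hu, huv, hn⟩ : ∃ u v, u ∈ w.support ∧ G.Adj u v ∧ s(u,v) ∉ w.edges := by
    by_contra hcon
    push Not at hcon
    have hall : ∀ y, ∀ p : G.Walk x y, y ∈ w.support := by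
      intro y p
      have : ∀ (a b : V) (p : G.Walk a b), a ∈ w.support → b ∈ w.support := by
        intro a b p
        induction p with
        | nil => exact id
        | cons h p ih =>
          intro ha
          exact ih (w.snd_mem_support_of_mem_edges (hcon _ _ ha h))
      exact this x y p w.start_mem_support
    apply hex
    intro e he
    induction e using Sym2.ind with
    | _ a b =>
      obtain ⟨p⟩ := hG.preconnected x a
      exact hcon a b (hall a p) he
  obtain ⟨w1, hw1, hp1⟩ := rot w hw hu
  have hn1 : s(u,v) ∉ w1.edges := by rwa [hp1.mem_iff]
  have : ∃ w' : G.Walk u u, Good w' ∧ w'.edges.Perm (s(u,v) :: s(u,v) :: w1.edges) := by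
    by_cases hv : v ∈ w1.support
    · exact ext2 w1 hw1 huv hv hn1
    · exact ext1 w1 hw1 huv hv
  obtain ⟨w', hw', hp'⟩ := this
  refine ⟨u, w', hw', ?_⟩
  have h1 := hp'.length_eq
  have h2 := hp1.length_eq
  simp only [List.length_cons, Walk.length_edges] at h1 h2
  omega

theorem len_le [Fintype V] {x : V} (w : G.Walk x x) (hw : Good w) :
    w.length ≤ 2 * Fintype.card (Sym2 V) := by
  rw [← Walk.length_edges, ← List.sum_toFinset_count_eq_length]
  calc _ ≤ ∑ e ∈ w.edges.toFinset, 2 :=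
        Finset.sum_le_sum fun e he => (hw.1 e (List.mem_toFinset.1 he)).le
    _ ≤ _ := by
      rw [Finset.sum_const, smul_eq_mul, mul_comm]
      exact Nat.mul_le_mul_left _ (Finset.card_le_univ _)

theorem exists_good [Fintype V] (hG : G.Connected) :
    ∃ (x : V) (w : G.Walk x x), Good w ∧ ∀ e ∈ G.edgeSet, e ∈ w.edges := by
  by_contra hcon
  have : ∀ n : ℕ, ∃ (x : V) (w : G.Walk x x), Good w ∧ n ≤ w.length := by
    intro n
    induction n with
    | zero =>
      obtain ⟨x⟩ := hG.nonempty
      exact ⟨x, Walk.nil, ⟨by simp, by simp⟩, by simp⟩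
    | succ n ih =>
      obtain ⟨x, w, hw, hl⟩ := ih
      obtain ⟨u, w', hw', hl'⟩ := step hG w hw (fun h => hcon ⟨x, w, hw, h⟩)
      exact ⟨u, w', hw', by omega⟩
  obtain ⟨x, w, hw, hl⟩ := this (2 * Fintype.card (Sym2 V) + 1)
  have := len_le w hw
  omega

theorem C_of_hasRep {x : V} (w : G.Walk x x) (z : V) (N : Set V) (h : HasRepetition w z N) :
    C w z N := by
  have key : ∀ i, i ≤ w.length → w.getVert (i % w.length) = w.getVert i := by
    intro i hi
    rcases hi.lt_or_eq with h | h
    · rw [Nat.mod_eq_of_lt h]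
    · rw [h]; simp
  refine ⟨?_, ?_⟩
  · intro i hi hz
    have := h (i+1) (by omega) hz
    rwa [show i + 1 + w.length - 1 = i + w.length by omega, Nat.add_mod_right, key _ (by omega),
      key _ (by omega)] at this
  · intro hz
    by_cases hl : w.length = 0
    · have : w.Nil := Walk.nil_iff_length_eq.2 hl
      cases this; simp
    have := h 0 (by omega) (by simpa using hz)
    rw [key _ (by omega), key _ (by omega), zero_add, zero_add] at this
    exact this

end ST

/-- Every finite connected simple graph admits a strong trace. -/
theorem exists_strong_trace {V : Type*} [Fintype V] [DecidableEq V]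
    (G : SimpleGraph V) (hG : G.Connected) :
    ∃ (x : V) (w : G.Walk x x), IsStrongTrace w := by
  obtain ⟨x, w, hw, hall⟩ := ST.exists_good hG
  refine ⟨x, w, fun e he => hw.1 e (hall e he), ?_⟩
  intro v N hN hne hneq hrep
  have H := hw.2 v N (ST.C_of_hasRep w v N hrep)
  obtain ⟨a, ha⟩ := hne
  apply hneq
  refine Set.Subset.antisymm hN fun b hb => ?_
  exact (H a b (hall _ (hN ha)) (hall _ hb)).1 ha
end

section
/- A finite connected simple graph G admits an antiparallel strong trace if and only if there exists a spanning tree T of G with the property that every connected component of the co-tree G - E(T) has an even number of edges. -/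
open SimpleGraph

namespace OFT

/-- cyclic chain -/
def Cyc {α : Type*} (r : α → α → Prop) : List α → Prop
  | [] => True
  | a :: l => List.IsChain r (a :: (l ++ [a]))

theorem cyc_cons {α : Type*} {r : α → α → Prop} {a : α} {l : List α} :
    Cyc r (a :: l) ↔ List.IsChain r (a :: (l ++ [a])) := Iff.rfl

theorem chain_mid {α : Type*} {r : α → α → Prop} {a c : α} {l m : List α} :
    List.IsChain r (a :: (l ++ c :: m)) ↔
      List.IsChain r (a :: (l ++ [c])) ∧ List.IsChain r (c :: m) :=
  List.isChain_cons_split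

theorem cyc_rot {α : Type*} {r : α → α → Prop} {l m : List α} :
    Cyc r (l ++ m) ↔ Cyc r (m ++ l) := by
  rcases l with _ | ⟨a, l⟩
  · simp
  rcases m with _ | ⟨b, m⟩
  · simp
  simp only [List.cons_append, cyc_cons, List.append_assoc]
  rw [chain_mid (m := m ++ [a]), chain_mid (m := l ++ [b]), and_comm]

theorem chain_end {α : Type*} {r r' : α → α → Prop} {x y : α} {l : List α} : ∀ {a : α},
    (∀ z ∈ a :: l, r z x → r' z y) → (∀ z ∈ a :: l, ∀ z' ∈ a :: l, r z z' → r' z z') →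
    List.IsChain r (a :: (l ++ [x])) → List.IsChain r' (a :: (l ++ [y])) := by
  induction l with
  | nil => intro a h1 h2 h; simp_all
  | cons b l ih =>
    intro a h1 h2 h
    simp only [List.cons_append, List.isChain_cons_cons] at h ⊢
    refine ⟨h2 _ (by simp) _ (by simp) h.1, ih ?_ ?_ h.2⟩
    · intro z hz; exact h1 z (List.mem_cons_of_mem _ hz)
    · intro z hz z' hz'; exact h2 z (List.mem_cons_of_mem _ hz) z' (List.mem_cons_of_mem _ hz')

structure OF {V : Type*} (L : List (V × V)) : Prop where
  nodup : L.Nodup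
  irr : ∀ d ∈ L, d.1 ≠ d.2
  sym : ∀ d ∈ L, d.swap ∈ L
  walk : Cyc (fun d d' => d.2 = d'.1) L
  strong : ∀ N : V × V → Prop, Cyc (fun d d' => N d.swap ↔ N d') L →
    ∀ d ∈ L, ∀ d' ∈ L, d.1 = d'.1 → (N d ↔ N d')

theorem OF.rot {V : Type*} {l m : List (V × V)} (h : OF (l ++ m)) : OF (m ++ l) := by
  have hm : ∀ d, d ∈ l ++ m ↔ d ∈ m ++ l := by intro d; simp [or_comm]
  refine ⟨?_, ?_, ?_, cyc_rot.1 h.walk, ?_⟩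
  · exact List.nodup_append_comm.1 h.nodup
  · intro d hd; exact h.irr d ((hm d).2 hd)
  · intro d hd; exact (hm _).1 (h.sym d ((hm d).2 hd))
  · intro N hN d hd d' hd'
    exact h.strong N (cyc_rot.1 hN) d ((hm d).2 hd) d' ((hm d').2 hd')

theorem OF.nil {V : Type*} : OF ([] : List (V × V)) := by
  refine ⟨by simp, by simp, by simp, trivial, by simp⟩

variable {V : Type*}

theorem ear_cyc {r : V × V → V × V → Prop} {e f g h a b c : V × V} {A B C : List (V × V)} :
    Cyc r (e :: f :: a :: A ++ g :: b :: B ++ h :: c :: C) ↔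
     (r e f ∧ r f a ∧ r g b ∧ r h c) ∧ List.IsChain r (a :: (A ++ [g])) ∧
      List.IsChain r (b :: (B ++ [h])) ∧ List.IsChain r (c :: (C ++ [e])) := by
  simp only [List.cons_append, cyc_cons, List.append_assoc]
  rw [List.isChain_cons_cons, List.isChain_cons_cons,
    chain_mid (l := A) (m := b :: (B ++ h :: c :: (C ++ [e]))), List.isChain_cons_cons,
    chain_mid (l := B) (m := c :: (C ++ [e])), List.isChain_cons_cons]
  tauto

theorem ear_cyc' {r : V × V → V × V → Prop} {a b c : V × V} {A B C : List (V × V)} :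
    Cyc r (a :: A ++ c :: C ++ b :: B) ↔
     List.IsChain r (a :: (A ++ [c])) ∧
      List.IsChain r (b :: (B ++ [a])) ∧ List.IsChain r (c :: (C ++ [b])) := by
  simp only [List.cons_append, cyc_cons, List.append_assoc]
  rw [chain_mid (l := A) (m := C ++ b :: (B ++ [a])), chain_mid (l := C) (m := B ++ [a])]
  tauto

theorem chain_last {N : V × V → Prop} {x y : V × V} {l : List (V × V)} {a : V × V}
    (h : List.IsChain (fun d d' => N d.swap ↔ N d') (a :: (l ++ [x]))) (hxy : N x ↔ N y) :
    List.IsChain (fun d d' => N d.swap ↔ N d') (a :: (l ++ [y])) :=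
  chain_end (fun _ _ h => h.trans hxy) (fun _ _ _ _ h => h) h

theorem chain_lastN {N : V × V → Prop} {x y : V × V} {l : List (V × V)} : ∀ {a : V × V},
    List.IsChain (fun d d' => N d.swap ↔ N d') (a :: (l ++ [x])) →
    List.IsChain (fun d d' => N d.swap ↔ N d') (a :: (l ++ [y])) → (N x ↔ N y) := by
  induction l with
  | nil => intro a h1 h2; simp at h1 h2; tauto
  | cons b l ih =>
    intro a h1 h2
    simp only [List.cons_append, List.isChain_cons_cons] at h1 h2
    exact ih h1.2 h2.2

theorem chain_last1 {x y : V × V} {l : List (V × V)} {a : V × V}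
    (h : List.IsChain (fun d d' : V × V => d.2 = d'.1) (a :: (l ++ [x]))) (hxy : x.1 = y.1) :
    List.IsChain (fun d d' : V × V => d.2 = d'.1) (a :: (l ++ [y])) :=
  chain_end (fun _ _ h => h.trans hxy) (fun _ _ _ _ h => h) h

theorem ear_add {u v w : V} {a b c : V × V} {A B C : List (V × V)}
    (h : OF (a :: A ++ c :: C ++ b :: B)) (ha : a.1 = w) (hc : c.1 = v) (hb : b.1 = u)
    (huv : u ≠ v) (hvw : v ≠ w) (huw : u ≠ w)
    (n1 : (u, v) ∉ a :: A ++ c :: C ++ b :: B) (n2 : (v, w) ∉ a :: A ++ c :: C ++ b :: B) :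
    OF ((u, v) :: (v, w) :: a :: A ++ (v, u) :: b :: B ++ (w, v) :: c :: C) := by
  have n3 : (v, u) ∉ a :: A ++ c :: C ++ b :: B := fun hh => n1 (h.sym _ hh)
  have n4 : (w, v) ∉ a :: A ++ c :: C ++ b :: B := fun hh => n2 (h.sym _ hh)
  have hm : ∀ d, d ∈ ((u, v) :: (v, w) :: a :: A ++ (v, u) :: b :: B ++ (w, v) :: c :: C) ↔
      (d = (u,v) ∨ d = (v,w) ∨ d = (v,u) ∨ d = (w,v)) ∨ d ∈ a :: A ++ c :: C ++ b :: B := by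
    intro d; simp only [List.mem_cons, List.mem_append]; tauto
  refine ⟨?_, ?_, ?_, ?_, ?_⟩
  · have hp : ((u, v) :: (v, w) :: a :: A ++ (v, u) :: b :: B ++ (w, v) :: c :: C).Perm
        ((u, v) :: (v, w) :: (v, u) :: (w, v) :: (a :: A ++ c :: C ++ b :: B)) := by
      classical
      rw [List.perm_iff_count]
      intro d
      simp only [List.count_append, List.count_cons, List.cons_append]
      omega
    rw [hp.nodup_iff]
    refine List.nodup_cons.2 ⟨?_, List.nodup_cons.2 ⟨?_, List.nodup_cons.2 ⟨?_, List.nodup_cons.2 ⟨n4, h.nodup⟩⟩⟩⟩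
    · intro hh
      rw [List.mem_cons, List.mem_cons, List.mem_cons] at hh
      rcases hh with hh | hh | hh | hh
      · exact huv (Prod.ext_iff.1 hh).1
      · exact huv (Prod.ext_iff.1 hh).1
      · exact huw (Prod.ext_iff.1 hh).1
      · exact n1 hh
    · intro hh
      rw [List.mem_cons, List.mem_cons] at hh
      rcases hh with hh | hh | hh
      · exact huw (Prod.ext_iff.1 hh).2.symm
      · exact hvw (Prod.ext_iff.1 hh).1
      · exact n2 hh
    · intro hh
      rw [List.mem_cons] at hh
      rcases hh with hh | hh
      · exact hvw (Prod.ext_iff.1 hh).1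
      · exact n3 hh
  · intro d hd
    rcases (hm d).1 hd with (rfl | rfl | rfl | rfl) | hd
    · exact huv
    · exact hvw
    · exact huv.symm
    · exact hvw.symm
    · exact h.irr d hd
  · intro d hd
    rw [hm]
    rcases (hm d).1 hd with (rfl | rfl | rfl | rfl) | hd
    · simp
    · simp
    · simp
    · simp
    · exact Or.inr (h.sym d hd)
  · have := ear_cyc'.1 h.walk
    rw [ear_cyc]
    refine ⟨⟨rfl, ha.symm, hb.symm, hc.symm⟩, chain_last1 this.1 hc, chain_last1 this.2.1 ha, chain_last1 this.2.2 hb⟩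
  · intro N hN
    rw [ear_cyc] at hN
    obtain ⟨⟨h1, h2, h3, h4⟩, hA, hB, hC⟩ := hN
    simp only [Prod.swap_prod_mk] at h1 h2 h3 h4
    have key := h.strong N (ear_cyc'.2 ⟨chain_last hA (h1.trans h4), chain_last hB h2, chain_last hC h3⟩)
    have ma : a ∈ a :: A ++ c :: C ++ b :: B := by simp
    have mb : b ∈ a :: A ++ c :: C ++ b :: B := by simp
    have mc : c ∈ a :: A ++ c :: C ++ b :: B := by simp
    have rep : ∀ d ∈ ((u, v) :: (v, w) :: a :: A ++ (v, u) :: b :: B ++ (w, v) :: c :: C),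
        ∃ d' ∈ a :: A ++ c :: C ++ b :: B, d.1 = d'.1 ∧ (N d ↔ N d') := by
      intro d hd
      rcases (hm d).1 hd with (rfl | rfl | rfl | rfl) | hd
      · exact ⟨b, mb, hb.symm, h3⟩
      · exact ⟨c, mc, hc.symm, h4⟩
      · exact ⟨c, mc, hc.symm, h1.trans h4⟩
      · exact ⟨a, ma, ha.symm, h2⟩
      · exact ⟨d, hd, rfl, Iff.rfl⟩
    intro d hd d' hd' hdd
    obtain ⟨x, hx, hx1, hx2⟩ := rep d hd
    obtain ⟨y, hy, hy1, hy2⟩ := rep d' hd'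
    rw [hx2, hy2]
    exact key x hx y hy (by rw [← hx1, ← hy1, hdd])

theorem ear_del {e f a b c : V × V} {A B C : List (V × V)}
    (h : OF (e :: f :: a :: A ++ e.swap :: b :: B ++ f.swap :: c :: C)) :
    OF (a :: A ++ c :: C ++ b :: B) := by
  classical
  have hp : (e :: f :: a :: A ++ e.swap :: b :: B ++ f.swap :: c :: C).Perm
        (e :: f :: e.swap :: f.swap :: (a :: A ++ c :: C ++ b :: B)) := by
      rw [List.perm_iff_count]
      intro d
      simp only [List.count_append, List.count_cons, List.cons_append]
      omega
  set L := e :: f :: a :: A ++ e.swap :: b :: B ++ f.swap :: c :: C with hL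
  set L' := a :: A ++ c :: C ++ b :: B with hL'
  have hn := hp.nodup_iff.1 h.nodup
  simp only [List.nodup_cons, List.mem_cons, not_or] at hn
  obtain ⟨⟨ef, eE, eF, eL⟩, ⟨fE, fF, fL⟩, ⟨EF, EL⟩, FL, hn'⟩ := hn
  have hm : ∀ d, d ∈ L' → d ∈ L := by
    intro d hd; rw [hp.mem_iff]; simp [hd]
  have hne : ∀ d ∈ L', d ≠ e ∧ d ≠ f ∧ d ≠ e.swap ∧ d ≠ f.swap := by
    intro d hd
    refine ⟨?_, ?_, ?_, ?_⟩ <;> rintro rfl <;> contradiction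
  have hne' : ∀ d ∈ L', d.swap ≠ e ∧ d.swap ≠ f ∧ d.swap ≠ e.swap ∧ d.swap ≠ f.swap := by
    intro d hd
    obtain ⟨h1, h2, h3, h4⟩ := hne d hd
    refine ⟨?_, ?_, ?_, ?_⟩
    · rintro rfl; simp at h3
    · rintro rfl; simp at h4
    · intro hh; exact h1 (Prod.swap_injective hh)
    · intro hh; exact h2 (Prod.swap_injective hh)
  have hw := h.walk
  rw [hL, ear_cyc] at hw
  obtain ⟨⟨w1, w2, w3, w4⟩, wA, wB, wC⟩ := hw
  simp only [Prod.snd_swap] at w1 w2 w3 w4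
  refine ⟨hn', fun d hd => h.irr d (hm d hd), ?_, ?_, ?_⟩
  · intro d hd
    have := h.sym d (hm d hd)
    rw [hp.mem_iff] at this
    simp only [List.mem_cons] at this
    obtain ⟨h1, h2, h3, h4⟩ := hne' d hd
    tauto
  · rw [hL', ear_cyc']
    refine ⟨chain_last1 wA ?_, chain_last1 wB ?_, chain_last1 wC ?_⟩
    · simp [w1, w4]
    · simp [w2]
    · simp [w3]
  · intro N hN
    rw [hL', ear_cyc'] at hN
    obtain ⟨hA, hB, hC⟩ := hN
    let M : V × V → Prop := fun d => if d = e then N b else if d = f ∨ d = e.swap then N c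
      else if d = f.swap then N a else N d
    have Me : M e ↔ N b := by simp [M]
    have Mf : M f ↔ N c := by simp [M, Ne.symm ef]
    have ME : M e.swap ↔ N c := by simp [M, Ne.symm eE]
    have MF : M f.swap ↔ N a := by simp [M, Ne.symm eF, Ne.symm fF, Ne.symm EF]
    have MN : ∀ d ∈ L', M d ↔ N d := by
      intro d hd
      obtain ⟨h1, h2, h3, h4⟩ := hne d hd
      simp [M, h1, h2, h3, h4]
    have MN' : ∀ d ∈ L', M d.swap ↔ N d.swap := by
      intro d hd
      obtain ⟨h1, h2, h3, h4⟩ := hne' d hd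
      simp only [M, h1, h2, h3, h4]; simp
    have ma : a ∈ L' := by simp [L']
    have mb : b ∈ L' := by simp [L']
    have mc : c ∈ L' := by simp [L']
    have sub : ∀ (x y q : V × V) (Q : List (V × V)), (∀ z ∈ q :: Q, z ∈ L') → (N x ↔ M y) →
        List.IsChain (fun d d' => N d.swap ↔ N d') (q :: (Q ++ [x])) →
        List.IsChain (fun d d' => M d.swap ↔ M d') (q :: (Q ++ [y])) := by
      intro x y q Q hq hxy hch
      refine chain_end ?_ ?_ hch
      · intro z hz hh
        rw [MN' z (hq z hz), ← hxy]; exact hh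
      · intro z hz z' hz' hh
        rw [MN' z (hq z hz), MN z' (hq z' hz')]; exact hh
    have key := h.strong M (by
      rw [hL, ear_cyc]
      refine ⟨⟨?_, ?_, ?_, ?_⟩, sub _ _ _ _ ?_ ME.symm hA, sub _ _ _ _ ?_ MF.symm hB, sub _ _ _ _ ?_ Me.symm hC⟩
      · rw [ME, Mf]
      · rw [MF, MN a ma]
      · rw [Prod.swap_swap, Me, MN b mb]
      · rw [Prod.swap_swap, Mf, MN c mc]
      · intro z hz; simp only [L', List.mem_append]; tauto
      · intro z hz; simp only [L', List.mem_append]; tauto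
      · intro z hz; simp only [L', List.mem_append]; tauto)
    intro d hd d' hd' hdd
    rw [← MN d hd, ← MN d' hd']
    exact key d (hm d hd) d' (hm d' hd') hdd

theorem leaf_add {u v : V} {L : List (V × V)} (h : OF L) (huv : u ≠ v)
    (hu : ∀ a ∈ L.head?, a.1 = u) (hv : ∀ d ∈ L, d.1 ≠ v) :
    OF ((u, v) :: (v, u) :: L) := by
  have n1 : (v, u) ∉ L := fun hh => hv _ hh rfl
  have n2 : (u, v) ∉ L := fun hh => hv _ (h.sym _ hh) rfl
  have e1 : ¬ ((u, v) = (v, u)) := fun hh => huv (Prod.ext_iff.1 hh).1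
  refine ⟨?_, ?_, ?_, ?_, ?_⟩
  · simp only [List.nodup_cons, List.mem_cons, not_or]
    exact ⟨⟨e1, n2⟩, n1, h.nodup⟩
  · intro d hd
    simp only [List.mem_cons] at hd
    rcases hd with rfl | rfl | hd
    · exact huv
    · exact huv.symm
    · exact h.irr d hd
  · intro d hd
    simp only [List.mem_cons] at hd ⊢
    rcases hd with rfl | rfl | hd
    · simp
    · simp
    · exact Or.inr (Or.inr (h.sym d hd))
  · rcases L with _ | ⟨a, L⟩
    · simp [cyc_cons]
    · have := h.walk
      have ha : a.1 = u := hu a (by simp)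
      rw [cyc_cons] at this ⊢
      simp only [List.cons_append, List.isChain_cons_cons]
      exact ⟨trivial, ha.symm, chain_last1 this ha⟩
  · intro N hN
    rcases L with _ | ⟨a, L⟩
    · intro d hd d' hd' hdd
      simp only [List.mem_cons, List.not_mem_nil, or_false] at hd hd'
      rcases hd with rfl | rfl <;> rcases hd' with rfl | rfl <;> simp_all
    · rw [cyc_cons] at hN
      simp only [List.cons_append, List.isChain_cons_cons, Prod.swap_prod_mk] at hN
      obtain ⟨-, h2, h3⟩ := hN
      have ha : a.1 = u := hu a (by simp)
      have key := h.strong N (chain_last h3 h2)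
      intro d hd d' hd' hdd
      rw [List.mem_cons, List.mem_cons] at hd hd'
      rcases hd with rfl | rfl | hd <;> rcases hd' with rfl | rfl | hd'
      · rfl
      · exact absurd hdd huv
      · rw [h2]; exact key a (by simp) d' hd' (by rw [ha, ← hdd])
      · exact absurd hdd.symm huv
      · rfl
      · exact absurd hdd.symm (hv d' hd')
      · rw [h2]; exact key d hd a (by simp) (by rw [ha, hdd])
      · exact absurd hdd (hv d hd)
      · exact key d hd d' hd' hdd

theorem leaf_del {e : V × V} {L : List (V × V)} (h : OF (e :: e.swap :: L)) :
    OF L ∧ (∀ a ∈ L.head?, a.1 = e.1) ∧ (∀ d ∈ L, d.1 ≠ e.2) := by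
  classical
  have hn := h.nodup
  simp only [List.nodup_cons, List.mem_cons, not_or] at hn
  obtain ⟨⟨eE, eL⟩, EL, hn'⟩ := hn
  have hne : ∀ d ∈ L, d ≠ e ∧ d ≠ e.swap := by
    intro d hd
    refine ⟨?_, ?_⟩ <;> rintro rfl <;> contradiction
  have hne' : ∀ d ∈ L, d.swap ≠ e ∧ d.swap ≠ e.swap := by
    intro d hd
    obtain ⟨h1, h3⟩ := hne d hd
    refine ⟨?_, ?_⟩
    · rintro rfl; simp at h3
    · intro hh; exact h1 (Prod.swap_injective hh)
  rcases L with _ | ⟨a, L⟩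
  · exact ⟨OF.nil, by simp, by simp⟩
  set L' := a :: L with hL'
  have hw := h.walk
  rw [cyc_cons] at hw
  simp only [L', List.cons_append, List.isChain_cons_cons, Prod.snd_swap] at hw
  obtain ⟨-, w2, w3⟩ := hw
  have key : ∀ (N : V × V → Prop) (p : Prop), Cyc (fun d d' => N d.swap ↔ N d') L' →
      ∀ d ∈ e :: e.swap :: L', ∀ d' ∈ e :: e.swap :: L', d.1 = d'.1 →
      ((if d = e then N a else if d = e.swap then p else N d) ↔
        (if d' = e then N a else if d' = e.swap then p else N d')) := by
    intro N p hN
    let M : V × V → Prop := fun d => (if d = e then N a else if d = e.swap then p else N d)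
    have Me : M e ↔ N a := by simp [M]
    have ME : M e.swap ↔ p := by simp [M, Ne.symm eE]
    have MN : ∀ d ∈ L', M d ↔ N d := by
      intro d hd
      obtain ⟨h1, h2⟩ := hne d hd
      simp [M, h1, h2]
    have MN' : ∀ d ∈ L', M d.swap ↔ N d.swap := by
      intro d hd
      obtain ⟨h1, h2⟩ := hne' d hd
      simp only [M, h1, h2]; simp
    refine h.strong M ?_
    rw [cyc_cons] at hN ⊢
    simp only [L', List.cons_append, List.isChain_cons_cons, Prod.swap_swap]
    refine ⟨trivial, by rw [Me, MN a (by simp [L'])], chain_end ?_ ?_ hN⟩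
    · intro z hz hh; rw [MN' z hz, Me]; exact hh
    · intro z hz z' hz' hh; rw [MN' z hz, MN z' hz']; exact hh
  refine ⟨⟨hn', fun d hd => h.irr d (by simp [hd]), ?_, ?_, ?_⟩, ?_, ?_⟩
  · intro d hd
    have := h.sym d (by simp [hd])
    simp only [List.mem_cons (l := e.swap :: L'), List.mem_cons (l := L')] at this
    obtain ⟨h1, h2⟩ := hne' d hd
    tauto
  · rw [hL', cyc_cons]
    exact chain_last1 w3 w2
  · intro N hN d hd d' hd' hdd
    have := key N False hN d (by simp [hd]) d' (by simp [hd']) hdd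
    obtain ⟨h1, h2⟩ := hne d hd
    obtain ⟨h3, h4⟩ := hne d' hd'
    simpa [h1, h2, h3, h4] using this
  · intro x hx
    simp [L'] at hx
    subst hx; exact w2.symm
  · intro d hd hh
    have := key (fun _ => True) False (by
      rw [hL', cyc_cons]; simp
      have : ∀ l : List (V × V), List.IsChain (fun _ _ : V × V => True) l := by
        intro l; induction l with
        | nil => simp
        | cons a l ih => cases l <;> simp_all
      exact this _) d (by simp [hd]) e.swap (by simp) hh
    obtain ⟨h1, h2⟩ := hne d hd
    simp [h1, h2, Ne.symm eE] at this

inductive Good : SimpleGraph V → Prop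
  | bot (H : SimpleGraph V) (h : ∀ a b, ¬ H.Adj a b) : Good H
  | add (H' H : SimpleGraph V) (u v w : V) (hg : Good H') (huv : u ≠ v) (hvw : v ≠ w) (huw : u ≠ w)
      (n1 : ¬ H'.Adj u v) (n2 : ¬ H'.Adj v w)
      (hH : ∀ a b, H.Adj a b ↔ H'.Adj a b ∨ s(a, b) = s(u, v) ∨ s(a, b) = s(v, w)) : Good H

theorem good_edgeSet {H' H : SimpleGraph V} {u v w : V}
    (hH : ∀ a b, H.Adj a b ↔ H'.Adj a b ∨ s(a, b) = s(u, v) ∨ s(a, b) = s(v, w)) (e : Sym2 V) :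
    e ∈ H.edgeSet ↔ e ∈ H'.edgeSet ∨ e = s(u, v) ∨ e = s(v, w) := by
  induction e using Sym2.ind with
  | _ a b => exact hH a b

theorem good_even [Fintype V] {H : SimpleGraph V} (h : Good H) :
    ∀ X : Set V, (∀ a b, H.Adj a b → (a ∈ X ↔ b ∈ X)) →
      Even ({e : Sym2 V | e ∈ H.edgeSet ∧ ∀ a ∈ e, a ∈ X}.ncard) := by
  induction h with
  | bot H h =>
    intro X hX
    have : {e : Sym2 V | e ∈ H.edgeSet ∧ ∀ a ∈ e, a ∈ X} = ∅ := by
      ext e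
      induction e using Sym2.ind with
      | _ a b => simp [h]
    simp [this]
  | add H' H u v w hg huv hvw huw n1 n2 hH ih =>
    intro X hX
    have i := ih X (fun a b hab => hX a b ((hH a b).2 (Or.inl hab)))
    have e1 := hX u v ((hH u v).2 (by simp))
    have e2 := hX v w ((hH v w).2 (by simp))
    by_cases hv : v ∈ X
    · have : {e : Sym2 V | e ∈ H.edgeSet ∧ ∀ a ∈ e, a ∈ X} =
        insert s(u, v) (insert s(v, w) {e : Sym2 V | e ∈ H'.edgeSet ∧ ∀ a ∈ e, a ∈ X}) := by
        ext e
        simp only [Set.mem_ofPred_eq, Set.mem_insert_iff, good_edgeSet hH]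
        constructor
        · tauto
        · rintro (rfl | rfl | h)
          · simp_all
          · simp_all
          · tauto
      rw [this, Set.ncard_insert_of_notMem, Set.ncard_insert_of_notMem]
      · rw [add_assoc]; exact i.add (by decide)
      · simp [n2]
      · simp [n1, huv, huw]
    · have : {e : Sym2 V | e ∈ H.edgeSet ∧ ∀ a ∈ e, a ∈ X} =
         {e : Sym2 V | e ∈ H'.edgeSet ∧ ∀ a ∈ e, a ∈ X} := by
        ext e
        simp only [Set.mem_ofPred_eq, good_edgeSet hH]
        constructor
        · rintro ⟨h | rfl | rfl, h2⟩
          · exact ⟨h, h2⟩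
          · exact absurd (h2 v (by simp)) hv
          · exact absurd (h2 v (by simp)) hv
        · tauto
      rw [this]; exact i

open Classical in
/-- parity of the number of edges assigned to x -/
noncomputable def par [Fintype V] (H : SimpleGraph V) (o : Sym2 V → V) (x : V) : ZMod 2 :=
  ∑ e ∈ H.edgeFinset, if o e = x then 1 else 0

open Classical in
theorem good_of_par [Fintype V] : ∀ (n : ℕ) (H : SimpleGraph V) (_ : H.edgeFinset.card = n)
    (o : Sym2 V → V) (_ : ∀ e ∈ H.edgeSet, o e ∈ e) (_ : ∀ x, par H o x = 0), Good H := by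
  intro n
  induction n using Nat.strong_induction_on with
  | _ n ih =>
  intro H hn o ho hp
  by_cases hb : ∀ a b, ¬ H.Adj a b
  · exact Good.bot H hb
  push Not at hb
  obtain ⟨a, b, hab⟩ := hb
  obtain ⟨e, he⟩ : ∃ e, e = s(a, b) := ⟨_, rfl⟩
  have heH : e ∈ H.edgeFinset := by rw [he]; simpa using hab
  obtain ⟨v, hv⟩ : ∃ v, o e = v := ⟨_, rfl⟩
  have hpv := hp v
  unfold par at hpv
  rw [← Finset.add_sum_erase _ _ heH] at hpv
  have : ∃ e' ∈ H.edgeFinset.erase e, o e' = v := by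
    by_contra hcon
    push Not at hcon
    rw [Finset.sum_eq_zero (fun x hx => by simp [hcon x hx])] at hpv
    simp [hv] at hpv
  obtain ⟨e', he', hv'⟩ := this
  rw [← Finset.add_sum_erase _ _ he'] at hpv
  have hne : e' ≠ e := (Finset.mem_erase.1 he').1
  have he'H : e' ∈ H.edgeFinset := (Finset.mem_erase.1 he').2
  have hve : v ∈ e := hv ▸ ho e (by simpa using heH)
  have hve' : v ∈ e' := hv' ▸ ho e' (by simpa using he'H)
  obtain ⟨u, rfl⟩ := Sym2.mem_iff_exists.1 hve
  obtain ⟨w, rfl⟩ := Sym2.mem_iff_exists.1 hve'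
  have hvu : H.Adj v u := by simpa using heH
  have hvw : H.Adj v w := by simpa using he'H
  have huw : u ≠ w := by rintro rfl; exact hne rfl
  obtain ⟨H', hH'⟩ : ∃ H', H' = H.deleteEdges {s(v, u), s(v, w)} := ⟨_, rfl⟩
  have hE : H'.edgeFinset = (H.edgeFinset.erase s(v, u)).erase s(v, w) := by
    ext e
    simp only [mem_edgeFinset, hH', edgeSet_deleteEdges, Finset.mem_erase, Set.mem_sdiff, Set.mem_insert_iff,
      Set.mem_singleton_iff]
    tauto
  refine Good.add H' H u v w ?_ hvu.ne' hvw.ne huw ?_ ?_ ?_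
  · refine ih _ ?_ _ rfl o ?_ ?_
    · rw [hE, ← hn]
      exact (Finset.card_erase_lt_of_mem he').trans (Finset.card_erase_lt_of_mem heH)
    · intro e he
      rw [hH', edgeSet_deleteEdges] at he
      exact ho e he.1
    · intro x
      have := hp x
      unfold par at this ⊢
      rw [← Finset.add_sum_erase _ _ heH, ← Finset.add_sum_erase _ _ he', ← add_assoc, hv, hv', 
        CharTwo.add_self_eq_zero, zero_add] at this
      rw [hE]; exact this
  · simp [hH', Sym2.eq_swap]
  · simp [hH']
  · intro a b
    simp only [hH', deleteEdges_adj, Set.mem_insert_iff, Set.mem_singleton_iff, Sym2.eq_swap (a := u) (b := v)]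
    constructor
    · tauto
    · rintro (h | h | h)
      · exact h.1
      · rw [← mem_edgeSet, h]; exact hvu
      · rw [← mem_edgeSet, h]; exact hvw

open Classical in
theorem par_flip [Fintype V] {H : SimpleGraph V} {u w : V} (p : H.Walk u w) : ∀ (o : Sym2 V → V)
    (_ : ∀ e ∈ H.edgeSet, o e ∈ e), ∃ o' : Sym2 V → V, (∀ e ∈ H.edgeSet, o' e ∈ e) ∧
      ∀ x, par H o' x = par H o x + (if u = x then 1 else 0) + (if w = x then 1 else 0) := by
  induction p with
  | nil => 
    intro o ho
    refine ⟨o, ho, fun x => ?_⟩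
    rw [add_assoc, CharTwo.add_self_eq_zero, add_zero]
  | @cons u v w h p ih =>
    intro o ho
    obtain ⟨o1, ho1, hp1⟩ := ih o ho
    have hmem : s(u, v) ∈ H.edgeFinset := by simpa using h
    obtain ⟨y, hy⟩ : ∃ y, s(u, v) = s(o1 s(u, v), y) := Sym2.mem_iff_exists.1 (ho1 _ h)
    refine ⟨Function.update o1 s(u, v) y, ?_, ?_⟩
    · intro e he
      by_cases hh : e = s(u, v)
      · subst hh
        simp only [Function.update_self]
        rw [hy]; simp
      · rw [Function.update_of_ne hh]; exact ho1 e he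
    · intro x
      have h1 : par H (Function.update o1 s(u, v) y) x = par H o1 x + 
          (if u = x then 1 else 0) + (if v = x then 1 else 0) := by
        unfold par
        rw [← Finset.add_sum_erase _ _ hmem, ← Finset.add_sum_erase _ (fun e => if o1 e = x then (1 : ZMod 2) else 0) hmem]
        rw [Finset.sum_congr rfl (g := fun e => if o1 e = x then (1 : ZMod 2) else 0)]
        · simp only [Function.update_self]
          generalize o1 s(u, v) = z at hy
          have : ∀ a b : ZMod 2, a = b + b + a := by decide
          have h3 : ∀ a b c: ZMod 2, b + a = c + a + c + b := by decide
          have h4 : ∀ a b c: ZMod 2, b + a = c + a + b + c := by decide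
          rcases Sym2.eq_iff.1 hy with ⟨rfl, rfl⟩ | ⟨rfl, rfl⟩
          · exact h3 _ _ _
          · exact h4 _ _ _
        · intro e he
          rw [Function.update_of_ne (Finset.mem_erase.1 he).1]
      rw [h1, hp1]
      have h3 : ∀ a b c d : ZMod 2, a + b + c + d + b = a + d + c := by decide
      exact h3 _ _ _ _

open Classical in
theorem even_good [Fintype V] {H : SimpleGraph V}
    (h : ∀ C : H.ConnectedComponent, Even ({e : Sym2 V | e ∈ H.edgeSet ∧ ∀ a ∈ e, a ∈ C.supp}.ncard)) :
    Good H := by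
  suffices hs : ∀ (n : ℕ) (o : Sym2 V → V) (_ : ∀ e ∈ H.edgeSet, o e ∈ e)
      (_ : (Finset.univ.filter (fun x => par H o x ≠ 0)).card = n), Good H by
    exact hs _ (fun e => e.out.1) (fun e _ => e.out_fst_mem) rfl
  intro n
  induction n using Nat.strong_induction_on with
  | _ n ih =>
  intro o ho hn
  by_cases hp : ∀ x, par H o x = 0
  · exact good_of_par _ H rfl o ho hp
  push Not at hp
  obtain ⟨v, hv⟩ := hp
  have hsum : ∑ x ∈ Finset.univ.filter (fun x => x ∈ (H.connectedComponentMk v).supp), par H o x = 0 := by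
    unfold par
    rw [Finset.sum_comm]
    have := h (H.connectedComponentMk v)
    rw [← ZMod.natCast_eq_zero_iff_even] at this
    refine Eq.trans ?_ this
    have e1 : {e : Sym2 V | e ∈ H.edgeSet ∧ ∀ a ∈ e, a ∈ (H.connectedComponentMk v).supp} =
       (H.edgeFinset.filter (fun e => o e ∈ (H.connectedComponentMk v).supp) : Finset (Sym2 V)) := by
      ext e
      simp only [Set.mem_ofPred_eq, Finset.coe_filter, mem_edgeFinset]
      constructor
      · rintro ⟨h1, h2⟩
        exact ⟨h1, h2 _ (ho e h1)⟩
      · rintro ⟨h1, h2⟩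
        refine ⟨h1, ?_⟩
        obtain ⟨y, hy⟩ := Sym2.mem_iff_exists.1 (ho e h1)
        intro a ha
        rw [hy] at ha
        rcases Sym2.mem_iff.1 ha with rfl | rfl
        · exact h2
        · rw [hy] at h1
          rw [ConnectedComponent.mem_supp_iff] at h2 ⊢
          rw [← h2]
          exact ConnectedComponent.sound (Adj.reachable h1).symm
    rw [e1, Set.ncard_coe_finset, Finset.card_filter]
    push_cast
    refine Finset.sum_congr rfl fun e he => ?_
    rw [Finset.sum_ite_eq]
    simp
  have hvm : v ∈ Finset.univ.filter (fun x => x ∈ (H.connectedComponentMk v).supp) := by simp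
  rw [← Finset.add_sum_erase _ _ hvm] at hsum
  obtain ⟨w, hw, hw0⟩ : ∃ w ∈ (Finset.univ.filter (fun x => x ∈ (H.connectedComponentMk v).supp)).erase v,
      par H o w ≠ 0 := by
    by_contra hcon
    push Not at hcon
    rw [Finset.sum_eq_zero hcon, add_zero] at hsum
    exact hv hsum
  simp only [Finset.mem_erase, Finset.mem_filter, Finset.mem_univ, true_and,
    ConnectedComponent.mem_supp_iff] at hw
  obtain ⟨p⟩ := (ConnectedComponent.exact hw.2).symm
  obtain ⟨o', ho', hp'⟩ := par_flip p o ho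
  refine ih _ ?_ o' ho' rfl
  rw [← hn]
  apply Finset.card_lt_card
  rw [Finset.ssubset_iff_of_subset]
  · refine ⟨v, by simpa using hv, ?_⟩
    have h1 : ∀ a : ZMod 2, a ≠ 0 → a + 1 = 0 := by decide
    simp [hp', hw.1, h1 _ hv]
  · intro x
    simp only [Finset.mem_filter, Finset.mem_univ, true_and, hp']
    intro hx h0
    rw [h0] at hx
    by_cases h1 : v = x
    · subst h1; exact hv h0
    · by_cases h2 : w = x
      · subst h2; exact hw0 h0
      · simp [h1, h2] at hx

theorem aux1 {P T E F : Prop} (h1 : E → ¬ T) (h2 : F → ¬ T) :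
    ((P ∨ E ∨ F) ∧ ¬ T) ↔ (P ∧ ¬ T) ∨ E ∨ F := by tauto

theorem aux2 {X P Q R S : Prop} : X ∨ (S ∨ R) ∨ (Q ∨ P) ↔ X ∨ (P ∨ Q) ∨ (R ∨ S) := by tauto

theorem ear_mem {d e f g k a b c : V × V} {A B C : List (V × V)} :
    d ∈ (e :: f :: a :: A ++ g :: b :: B ++ k :: c :: C) ↔
      d ∈ a :: A ++ c :: C ++ b :: B ∨ (d = e ∨ d = g) ∨ (d = f ∨ d = k) := by
  simp only [List.mem_cons, List.mem_append]; tauto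

theorem min_seg : ∀ (n : ℕ) (e : V × V) (M R : List (V × V)), M.length = n →
    OF (e :: (M ++ e.swap :: R)) → ∃ (e' : V × V) (M' R' : List (V × V)),
      OF (e' :: (M' ++ e'.swap :: R')) ∧
      (e' :: (M' ++ e'.swap :: R')).Perm (e :: (M ++ e.swap :: R)) ∧ ∀ d ∈ M', d.swap ∉ M' := by
  classical
  intro n
  induction n using Nat.strong_induction_on with
  | _ n ih =>
  intro e M R hn h
  by_cases hM : ∀ d ∈ M, d.swap ∉ M
  · exact ⟨e, M, R, h, List.Perm.refl _, hM⟩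
  push Not at hM
  obtain ⟨d, hd, hds⟩ := hM
  have hdd : d.swap ≠ d := by
    intro hh
    exact h.irr d (by simp [hd]) (Prod.ext_iff.1 hh).2
  obtain ⟨M1, M2, rfl⟩ := List.append_of_mem hd
  simp only [List.mem_append, List.mem_cons, hdd, false_or] at hds
  rcases hds with hds | hds
  · obtain ⟨P, Q, rfl⟩ := List.append_of_mem hds
    have h' : OF (d.swap :: (Q ++ d.swap.swap :: (M2 ++ e.swap :: R ++ e :: P))) := by
      have := OF.rot (l := e :: P) (m := d.swap :: (Q ++ d :: (M2 ++ e.swap :: R)))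
        (by simpa using h)
      simpa using this
    obtain ⟨e', M', R', h1, h2, h3⟩ := ih Q.length (by simp at hn; omega) _ _ _ rfl h'
    refine ⟨e', M', R', h1, h2.trans ?_, h3⟩
    rw [List.perm_iff_count]
    intro x
    simp only [List.count_append, List.count_cons, List.cons_append, Prod.swap_swap]
    omega
  · obtain ⟨P, Q, rfl⟩ := List.append_of_mem hds
    have h' : OF (d :: (P ++ d.swap :: (Q ++ e.swap :: R ++ e :: M1))) := by
      have := OF.rot (l := e :: M1) (m := d :: (P ++ d.swap :: (Q ++ e.swap :: R)))
        (by simpa using h)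
      simpa using this
    obtain ⟨e', M', R', h1, h2, h3⟩ := ih P.length (by simp at hn; omega) _ _ _ rfl h'
    refine ⟨e', M', R', h1, h2.trans ?_, h3⟩
    rw [List.perm_iff_count]
    intro x
    simp only [List.count_append, List.count_cons, List.cons_append]
    omega

/-- graph of a one-face list -/
def gr (L : List (V × V)) (h : OF L) : SimpleGraph V where
  Adj a b := (a, b) ∈ L
  symm := ⟨fun _ _ hab => h.sym _ hab⟩
  loopless := ⟨fun _ haa => h.irr _ haa rfl⟩

theorem gr_adj {L : List (V × V)} {h : OF L} {a b : V} : (gr L h).Adj a b ↔ (a, b) ∈ L := Iff.rfl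

theorem eq_gr {d : V × V} {x y : V} :
   s(x, y) = s(d.1, d.2) ↔ (x, y) = d ∨ (x, y) = d.swap := by
  rw [Sym2.eq_iff, Prod.ext_iff, Prod.ext_iff]; simp

set_option maxHeartbeats 1000000 in
theorem of_tree : ∀ (n : ℕ) (L : List (V × V)) (_ : L.length = n) (h : OF L),
    ∃ T : SimpleGraph V, T ≤ gr L h ∧ T.IsAcyclic ∧ Good (gr L h \ T) ∧
      ∀ d ∈ L, ∀ d' ∈ L, T.Reachable d.1 d'.1 := by
  intro n
  induction n using Nat.strong_induction_on with
  | _ n ih =>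
  intro L0 hn h0
  rcases L0 with _ | ⟨e0, L0⟩
  · refine ⟨⊥, bot_le, isAcyclic_bot, Good.bot _ ?_, by simp⟩
    intro a b; simp [gr_adj]
  have hs0 := h0.sym e0 (by simp)
  have hss : e0.swap ≠ e0 := by
    intro hh
    exact h0.irr e0 (by simp) (Prod.ext_iff.1 hh).2
  simp only [List.mem_cons, hss, false_or] at hs0
  obtain ⟨M0, R0, rfl⟩ := List.append_of_mem hs0
  obtain ⟨e, M, R, h, hperm, hmin⟩ := min_seg _ e0 M0 R0 rfl h0
  have hlen := hperm.length_eq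
  have hgr : gr _ h0 = gr _ h := by
    ext a b; rw [gr_adj, gr_adj, hperm.mem_iff]
  rw [hgr]
  suffices hsuff : ∃ T : SimpleGraph V, T ≤ gr _ h ∧ T.IsAcyclic ∧ Good (gr _ h \ T) ∧
      ∀ d ∈ (e :: (M ++ e.swap :: R)), ∀ d' ∈ (e :: (M ++ e.swap :: R)), T.Reachable d.1 d'.1 by
    obtain ⟨T, h1, h2, h3, h4⟩ := hsuff
    exact ⟨T, h1, h2, h3, fun d hd d' hd' => h4 d (hperm.mem_iff.2 hd) d' (hperm.mem_iff.2 hd')⟩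
  rw [← hlen] at hn
  clear hlen hgr hperm hss hs0 h0 
  rcases M with _ | ⟨f, A⟩
  · -- leaf case
    obtain ⟨hR, hhead, hleaf⟩ := leaf_del h
    obtain ⟨T, h1, h2, h3, h4⟩ := ih R.length (by simp at hn; omega) R rfl hR
    have hne : e.1 ≠ e.2 := h.irr e (by simp)
    have hnr : ¬ T.Reachable e.1 e.2 := by
      intro hr
      obtain ⟨p⟩ := hr.symm
      have key : ∀ {x y : V} (p : T.Walk x y), x = e.2 → y = e.1 → False := by
        intro x y p hx hy
        cases p with
        | nil => exact hne (hy.symm.trans hx)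
        | cons hadj q => exact hleaf _ (h1 hadj) hx
      exact key p rfl rfl
    have hTe : ∀ a b, (T ⊔ edge e.1 e.2).Adj a b ↔ T.Adj a b ∨ (a, b) = e ∨ (a, b) = e.swap := by
      intro a b
      rw [sup_adj, edge_adj, Prod.ext_iff, Prod.ext_iff]
      simp only [Prod.fst_swap, Prod.snd_swap]
      constructor
      · tauto
      · rintro (hh | ⟨rfl, rfl⟩ | ⟨rfl, rfl⟩)
        · tauto
        · tauto
        · exact Or.inr ⟨by tauto, hne.symm⟩
    have hee : (T ⊔ edge e.1 e.2).Adj e.1 e.2 := (hTe _ _).2 (by simp)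
    refine ⟨T ⊔ edge e.1 e.2, ?_, h2.sup_edge_of_not_reachable hnr, ?_, ?_⟩
    · intro a b hab
      rw [gr_adj]
      rcases (hTe a b).1 hab with hh | hh | hh
      · have := gr_adj.1 (h1 hh); simp [this]
      · simp [hh]
      · simp [hh]
    · convert h3 using 1
      ext a b
      rw [sdiff_adj, sdiff_adj, hTe, gr_adj, gr_adj]
      have hn := h.nodup
      simp only [List.nil_append, List.nodup_cons, List.mem_cons, not_or] at hn ⊢
      constructor
      · tauto
      · rintro ⟨h5, h6⟩
        refine ⟨by tauto, h6, fun h7 => ?_, fun h7 => ?_⟩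
        · exact hn.1.2 (h7 ▸ h5)
        · exact hn.2.1 (h7 ▸ h5)
    · have key : ∀ d ∈ (e :: ([] ++ e.swap :: R)), (T ⊔ edge e.1 e.2).Reachable d.1 e.1 := by
        intro d hd
        simp only [List.nil_append, List.mem_cons] at hd
        rcases hd with rfl | rfl | hd
        · exact Reachable.refl _
        · exact hee.reachable.symm
        · rcases R with _ | ⟨a, R⟩
          · simp at hd
          · rw [← hhead a (by simp)]
            exact (h4 d hd a (by simp)).mono le_sup_left
      intro d hd d' hd'
      exact (key d hd).trans (key d' hd').symm
  · -- ear case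
    have hnd := h.nodup
    simp only [List.cons_append, List.nodup_cons, List.mem_cons, List.mem_append, not_or] at hnd
    have hfF := h.sym f (by simp)
    have hfsR : f.swap ∈ R := by
      simp only [List.cons_append, List.mem_cons, List.mem_append] at hfF
      have h1 := hmin f (by simp)
      simp only [List.mem_cons, not_or] at h1
      rcases hfF with hh | hh | hh | hh | hh
      · have : f = e.swap := by rw [← hh]; simp
        exact absurd this hnd.2.1.2.1
      · exact absurd hh h1.1
      · exact absurd hh h1.2
      · exact absurd (Prod.swap_injective hh).symm hnd.1.1
      · exact hh
    obtain ⟨B, C, rfl⟩ := List.append_of_mem hfsR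
    have hw := h.walk
    have hef : e.2 = f.1 := by
      rw [cyc_cons] at hw
      simp only [List.cons_append, List.isChain_cons_cons] at hw
      exact hw.1
    have hirr := h.irr
    have hie := h.irr e (by simp)
    have hif := h.irr f (by simp)
    rcases A with _ | ⟨a, A⟩
    · exfalso
      rw [cyc_cons] at hw
      simp only [List.cons_append, List.nil_append, List.isChain_cons_cons, Prod.fst_swap] at hw
      exact hif (by rw [← hef, hw.2.1])
    rcases B with _ | ⟨b, B⟩
    · exfalso
      have : Cyc (fun d d' : V × V => d.2 = d'.1) (e.swap :: f.swap :: (C ++ e :: f :: a :: A)) := by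
        have := (cyc_rot (l := e :: f :: a :: A) (m := e.swap :: f.swap :: C)).1 (by simpa using hw)
        simpa using this
      rw [cyc_cons] at this
      simp only [List.cons_append, List.isChain_cons_cons, Prod.fst_swap, Prod.snd_swap] at this
      exact hnd.2.1.2.1 (Prod.ext_iff.2 ⟨by simp [hef], by simp [this.1]⟩)
    rcases C with _ | ⟨c, C⟩
    · exfalso
      have : Cyc (fun d d' : V × V => d.2 = d'.1) (f.swap :: (e :: f :: a :: A ++ e.swap :: b :: B)) := by
        have := (cyc_rot (l := e :: f :: a :: A ++ e.swap :: b :: B) (m := [f.swap])).1 (by simpa using hw)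
        simpa using this
      rw [cyc_cons] at this
      simp only [List.cons_append, List.isChain_cons_cons, Prod.fst_swap, Prod.snd_swap] at this
      exact hie (by rw [hef, this.1])
    have hLeq : (e :: (f :: a :: A ++ e.swap :: (b :: B ++ f.swap :: c :: C))) =
      e :: f :: a :: A ++ e.swap :: b :: B ++ f.swap :: c :: C := by simp
    have h' := ear_del (hLeq ▸ h)
    rw [hLeq, ear_cyc] at hw
    obtain ⟨⟨-, w2, w3, w4⟩, -⟩ := hw
    simp only [Prod.snd_swap] at w2 w3 w4
    obtain ⟨T, h1, h2, h3, h4⟩ := ih _ (by simp at hn ⊢; omega) _ rfl h'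
    have hm : ∀ d, d ∈ (e :: (f :: a :: A ++ e.swap :: (b :: B ++ f.swap :: c :: C))) ↔
        d ∈ a :: A ++ c :: C ++ b :: B ∨ (d = e ∨ d = e.swap) ∨ (d = f ∨ d = f.swap) := by
      intro d; rw [hLeq]; exact ear_mem
    have hfe : f ≠ e.swap := hnd.2.1.2.1
    refine ⟨T, ?_, h2, ?_, ?_⟩
    · intro x y hxy
      exact (hm _).2 (Or.inl (h1 hxy))
    · have n1 : (e.1, e.2) ∉ a :: A ++ c :: C ++ b :: B := by
        have := hnd.1
        simp only [List.mem_cons, List.mem_append] at this ⊢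
        tauto
      have n2 : (f.1, f.2) ∉ a :: A ++ c :: C ++ b :: B := by
        have := hnd.2.1
        simp only [List.mem_cons, List.mem_append] at this ⊢
        tauto
      have hadj : ∀ x y, (gr _ h).Adj x y ↔ (gr _ h').Adj x y ∨ s(x, y) = s(e.1, e.2) ∨ s(x, y) = s(f.1, f.2) := by
        intro x y
        rw [gr_adj, gr_adj, hm, eq_gr, eq_gr]
      have t1 : ∀ x y, s(x, y) = s(e.1, e.2) → ¬ T.Adj x y := by
        intro x y hxy hT
        rw [← mem_edgeSet, hxy] at hT
        exact n1 (h1 hT)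
      have t2 : ∀ x y, s(x, y) = s(f.1, f.2) → ¬ T.Adj x y := by
        intro x y hxy hT
        rw [← mem_edgeSet, hxy] at hT
        exact n2 (h1 hT)
      refine Good.add _ _ e.1 e.2 f.2 h3 hie (hef ▸ hif) ?_ ?_ ?_ ?_
      · intro hh
        exact hfe (Prod.ext_iff.2 ⟨by simp [hef], by simp [hh]⟩)
      · rw [sdiff_adj]
        exact fun hh => n1 hh.1
      · rw [sdiff_adj, hef]
        exact fun hh => n2 hh.1
      · intro x y
        rw [sdiff_adj, sdiff_adj, hadj]
        rw [show s(e.2, f.2) = s(f.1, f.2) by rw [hef]]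
        exact aux1 (t1 x y) (t2 x y)
    · have key : ∀ d ∈ (e :: (f :: a :: A ++ e.swap :: (b :: B ++ f.swap :: c :: C))),
          ∃ d' ∈ a :: A ++ c :: C ++ b :: B, d.1 = d'.1 := by
        intro d hd
        rcases (hm d).1 hd with hd | (rfl | rfl) | (rfl | rfl)
        · exact ⟨d, hd, rfl⟩
        · exact ⟨b, by simp, w3⟩
        · exact ⟨c, by simp, by simp [hef, w4]⟩
        · exact ⟨c, by simp, w4⟩
        · exact ⟨a, by simp, by simp [w2]⟩
      intro d hd d' hd'
      obtain ⟨x, hx, hx'⟩ := key d hd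
      obtain ⟨y, hy, hy'⟩ := key d' hd'
      rw [hx', hy']
      exact h4 x hx y hy

theorem exists_nbr {T : SimpleGraph V} (hT : T.Connected) {x y : V} (hxy : x ≠ y) : ∃ z, T.Adj x z := by
  obtain ⟨p⟩ := hT.preconnected x y
  cases p with
  | nil => exact absurd rfl hxy
  | cons h _ => exact ⟨_, h⟩

theorem spanning_of_OF {G : SimpleGraph V} (hG : G.Connected) {L : List (V × V)} (h : OF L)
    (hL : ∀ a b, G.Adj a b ↔ (a, b) ∈ L) : ∃ T : SimpleGraph V, T ≤ G ∧ T.Connected ∧ T.IsAcyclic ∧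
      Good (G \ T) := by
  have : G = gr L h := by ext a b; rw [hL, gr_adj]
  subst this
  obtain ⟨T, h1, h2, h3, h4⟩ := of_tree _ L rfl h
  refine ⟨T, h1, ?_, h2, h3⟩
  have := hG.nonempty
  refine ⟨?_⟩
  intro x y
  by_cases hxy : x = y
  · subst hxy; rfl
  obtain ⟨z, hz⟩ := exists_nbr hG hxy
  obtain ⟨z', hz'⟩ := exists_nbr hG (Ne.symm hxy)
  exact h4 _ hz _ hz'

theorem chain_reach {K : SimpleGraph V} {x : V × V} {l : List (V × V)} : ∀ {a : V × V},
    List.IsChain (fun d d' : V × V => d.2 = d'.1) (a :: (l ++ [x])) →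
    (∀ z ∈ a :: l, K.Adj z.1 z.2) → ∀ z ∈ a :: l, K.Reachable a.1 z.1 := by
  induction l with
  | nil => intro a _ _ z hz; simp at hz; subst hz; rfl
  | cons b l ih =>
    intro a h hK z hz
    simp only [List.cons_append, List.isChain_cons_cons] at h
    rw [List.mem_cons] at hz
    rcases hz with rfl | hz
    · rfl
    · have h1 := ih h.2 (fun z hz => hK z (List.mem_cons_of_mem _ hz)) z hz
      have h2 : K.Adj a.1 b.1 := h.1 ▸ hK a (by simp)
      exact h2.reachable.trans h1

theorem OF.reach {K : SimpleGraph V} {L : List (V × V)} (h : OF L) (hK : ∀ z ∈ L, K.Adj z.1 z.2) :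
    ∀ d ∈ L, ∀ d' ∈ L, K.Reachable d.1 d'.1 := by
  rcases L with _ | ⟨a, L⟩
  · simp
  · intro d hd d' hd'
    have := chain_reach h.walk hK
    exact (this d hd).symm.trans (this d' hd')

theorem tree_ext {T : SimpleGraph V} (hT : T.Connected) (hA : T.IsAcyclic) {L : List (V × V)} (h : OF L)
    (hL : ∀ d ∈ L, T.Adj d.1 d.2) {a b : V} (hab : T.Adj a b) (hn : (a, b) ∉ L) :
    ∃ L', OF L' ∧ (∀ d ∈ L', T.Adj d.1 d.2) ∧ L.length < L'.length := by
  rcases L with _ | ⟨d0, L⟩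
  · refine ⟨_, leaf_add (u := a) (v := b) h hab.ne (by simp) (by simp), ?_, by simp⟩
    intro d hd
    simp only [List.mem_cons, List.not_mem_nil, or_false] at hd
    rcases hd with rfl | rfl
    · exact hab
    · exact hab.symm
  set M := d0 :: L with hM
  let S : Set V := {x | ∃ d ∈ M, d.1 = x}
  have hd0 : d0.1 ∈ S := ⟨d0, by simp [M], rfl⟩
  have hS : a ∉ S ∨ b ∉ S := by
    by_contra hcon
    push Not at hcon
    obtain ⟨⟨d, hd, rfl⟩, ⟨d', hd', rfl⟩⟩ := hcon
    have hb := isAcyclic_iff_forall_adj_isBridge.1 hA hab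
    rw [isBridge_iff] at hb
    apply hb
    refine h.reach ?_ d hd d' hd'
    intro z hz
    rw [deleteEdges_adj]
    refine ⟨hL z hz, ?_⟩
    rw [Set.mem_singleton_iff, Sym2.eq_iff]
    rintro (⟨h1, h2⟩ | ⟨h1, h2⟩)
    · exact hn (by rw [← h1, ← h2]; exact hz)
    · exact hn (by rw [← h1, ← h2]; exact h.sym z hz)
  have hbd : ∃ u v, T.Adj u v ∧ u ∈ S ∧ v ∉ S := by
    have : ∃ y, y ∉ S := by tauto
    obtain ⟨y, hy⟩ := this
    obtain ⟨p⟩ := hT.preconnected d0.1 y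
    obtain ⟨d, -, h1, h2⟩ := p.exists_boundary_dart S hd0 hy
    exact ⟨_, _, d.adj, h1, h2⟩
  obtain ⟨u, v, huv, ⟨d, hd, rfl⟩, hv⟩ := hbd
  obtain ⟨P, Q, hPQ⟩ := List.append_of_mem hd
  rw [hPQ] at h
  have hm : ∀ x, x ∈ d :: Q ++ P ↔ x ∈ M := by
    intro x; rw [hPQ]; simp only [List.mem_append, List.mem_cons]; tauto
  refine ⟨_, leaf_add (u := d.1) (v := v) h.rot huv.ne (by simp) ?_, ?_, ?_⟩
  · intro x hx hxv
    exact hv ⟨x, (hm x).1 hx, hxv⟩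
  · intro x hx
    rw [List.mem_cons, List.mem_cons, hm] at hx
    rcases hx with rfl | rfl | hx
    · exact huv
    · exact huv.symm
    · exact hL x hx
  · rw [hPQ]; simp; omega

theorem tree_OF [Fintype V] {T : SimpleGraph V} (hT : T.Connected) (hA : T.IsAcyclic) :
    ∃ L, OF L ∧ ∀ a b, T.Adj a b ↔ (a, b) ∈ L := by
  classical
  by_contra hcon
  have key : ∀ n : ℕ, ∃ L : List (V × V), OF L ∧ (∀ d ∈ L, T.Adj d.1 d.2) ∧ n ≤ L.length := by
    intro n
    induction n with
    | zero => exact ⟨[], OF.nil, by simp, by simp⟩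
    | succ n ih =>
      obtain ⟨L, h1, h2, h3⟩ := ih
      have : ∃ a b, T.Adj a b ∧ (a, b) ∉ L := by
        by_contra hc
        push Not at hc
        exact hcon ⟨L, h1, fun a b => ⟨hc a b, fun hab => h2 _ hab⟩⟩
      obtain ⟨a, b, hab, hn⟩ := this
      obtain ⟨L', h4, h5, h6⟩ := tree_ext hT hA h1 h2 hab hn
      exact ⟨L', h4, h5, by omega⟩
  obtain ⟨L, h1, -, h3⟩ := key (Fintype.card (V × V) + 1)
  have := h1.nodup.length_le_card
  omega

set_option maxHeartbeats 1000000 in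
theorem good_OF [Fintype V] {T : SimpleGraph V} (hT : T.Connected) (hA : T.IsAcyclic)
    {H : SimpleGraph V} (hH : Good H) : (∀ a b, H.Adj a b → ¬ T.Adj a b) →
    ∃ L, OF L ∧ ∀ d : V × V, d ∈ L ↔ T.Adj d.1 d.2 ∨ H.Adj d.1 d.2 := by
  induction hH with
  | bot H h =>
    intro _
    obtain ⟨L, h1, h2⟩ := tree_OF hT hA
    exact ⟨L, h1, fun d => by simp [h, h2]⟩
  | add H' H u v w hg huv hvw huw n1 n2 hH ih =>
    intro hdis
    obtain ⟨L, h1, h2⟩ := ih (fun a b hab => hdis a b ((hH a b).2 (Or.inl hab)))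
    obtain ⟨u', hu'⟩ := exists_nbr hT huv
    obtain ⟨v', hv'⟩ := exists_nbr hT hvw
    obtain ⟨w', hw'⟩ := exists_nbr hT huw.symm
    have mu : (u, u') ∈ L := (h2 _).2 (Or.inl hu')
    have mv : (v, v') ∈ L := (h2 _).2 (Or.inl hv')
    have mw : (w, w') ∈ L := (h2 _).2 (Or.inl hw')
    have t1 : (u, v) ∉ L := by
      rw [h2]; rintro (h | h)
      · exact hdis u v ((hH u v).2 (by simp)) h
      · exact n1 h
    have t2 : (v, w) ∉ L := by
      rw [h2]; rintro (h | h)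
      · exact hdis v w ((hH v w).2 (by simp)) h
      · exact n2 h
    have t1' : (v, u) ∉ L := fun hh => t1 (h1.sym _ hh)
    have t2' : (w, v) ∉ L := fun hh => t2 (h1.sym _ hh)
    have hsu : ∀ d : V × V, s(d.1, d.2) = s(u, v) ↔ d = (u, v) ∨ d = (v, u) := by
      intro d; rw [Sym2.eq_iff, Prod.ext_iff, Prod.ext_iff]
    have hsv : ∀ d : V × V, s(d.1, d.2) = s(v, w) ↔ d = (v, w) ∨ d = (w, v) := by
      intro d; rw [Sym2.eq_iff, Prod.ext_iff, Prod.ext_iff]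
    obtain ⟨P, Q, hPQ⟩ := List.append_of_mem mw
    have h1' := h1
    rw [hPQ] at h1'
    have h1' := h1'.rot
    have hm : ∀ x, x ∈ (w, w') :: Q ++ P ↔ x ∈ L := by
      intro x; rw [hPQ]; simp only [List.mem_append, List.mem_cons]; tauto
    rw [List.cons_append] at h1' hm
    generalize Q ++ P = M at h1' hm
    have mv' : (v, v') ∈ M := by
      have := (hm _).2 mv
      rw [List.mem_cons] at this
      rcases this with h | h
      · exact absurd (Prod.ext_iff.1 h).1 hvw
      · exact h
    have mu' : (u, u') ∈ M := by
      have := (hm _).2 mu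
      rw [List.mem_cons] at this
      rcases this with h | h
      · exact absurd (Prod.ext_iff.1 h).1 huw
      · exact h
    obtain ⟨A, D, rfl⟩ := List.append_of_mem mv'
    rw [List.mem_append, List.mem_cons] at mu'
    rcases mu' with mu' | mu' | mu'
    · obtain ⟨X, Y, rfl⟩ := List.append_of_mem mu'
      have h5 : OF ((u, u') :: Y ++ (v, v') :: D ++ (w, w') :: X) := by
        have := OF.rot (l := (w, w') :: X) (m := (u, u') :: Y ++ (v, v') :: D) (by simpa using h1')
        simpa using this
      have hm' : ∀ x, x ∈ (u, u') :: Y ++ (v, v') :: D ++ (w, w') :: X ↔ x ∈ L := by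
        intro x; rw [← hm]; simp only [List.mem_append, List.mem_cons]; tauto
      refine ⟨_, ear_add (u := w) (v := v) (w := u) h5 rfl rfl rfl hvw.symm huv.symm huw.symm ?_ ?_, ?_⟩
      · rwa [hm']
      · rwa [hm']
      · intro d
        have h6 := hm' d
        rw [h2] at h6
        rw [hH, hsu, hsv, ← or_assoc, ← h6, ear_mem]
        exact aux2
    · exact absurd (Prod.ext_iff.1 mu').1 huv
    · obtain ⟨X, Y, rfl⟩ := List.append_of_mem mu'
      have h5 : OF ((w, w') :: A ++ (v, v') :: X ++ (u, u') :: Y) := by simpa using h1'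
      have hm' : ∀ x, x ∈ (w, w') :: A ++ (v, v') :: X ++ (u, u') :: Y ↔ x ∈ L := by
        intro x; rw [← hm]; simp only [List.mem_append, List.mem_cons]; tauto
      refine ⟨_, ear_add (u := u) (v := v) (w := w) h5 rfl rfl rfl huv hvw huw ?_ ?_, ?_⟩
      · rwa [hm']
      · rwa [hm']
      · intro d
        have h6 := hm' d
        rw [h2] at h6
        rw [hH, hsu, hsv, ← or_assoc, ← h6, ear_mem]

theorem cyc_idx {α : Type*} {r : α → α → Prop} {L : List α} :
    Cyc r L ↔ ∀ (i : ℕ) (hi : i < L.length), r L[i] (L[(i + 1) % L.length]'(Nat.mod_lt _ (by omega))) := by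
  rcases L with _ | ⟨a, l⟩
  · simp [Cyc]
  rw [cyc_cons, List.isChain_iff_getElem]
  have h1 : ∀ (i : ℕ) (hi : i < (a :: l).length) (hi' : i < (a :: (l ++ [a])).length),
      (a :: (l ++ [a]))[i] = (a :: l)[i] := by
    intro i hi hi'
    simp only [← List.cons_append]
    rw [List.getElem_append_left hi]
  have h2 : ∀ (i : ℕ) (hi : i < (a :: l).length) (hi' : i + 1 < (a :: (l ++ [a])).length),
      (a :: (l ++ [a]))[i + 1] = (a :: l)[(i + 1) % (a :: l).length]'(Nat.mod_lt _ (by omega)) := by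
    intro i hi hi'
    by_cases hh : i + 1 < (a :: l).length
    · rw [h1 _ hh]
      simp only [Nat.mod_eq_of_lt hh]
    · have : i + 1 = (a :: l).length := by omega
      simp only [this, Nat.mod_self]
      simp
  constructor
  · intro h i hi
    have := h i (by simp at hi ⊢; omega)
    rwa [h1 i hi, h2 i hi] at this
  · intro h i hi
    have hi' : i < (a :: l).length := by simp at hi ⊢; omega
    rw [h1 i hi', h2 i hi']
    exact h i hi'

/-- list of pairs of a walk -/
def prs {G : SimpleGraph V} {x y : V} (w : G.Walk x y) : List (V × V) := w.darts.map SimpleGraph.Dart.toProd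

theorem prs_length {G : SimpleGraph V} {x y : V} (w : G.Walk x y) : (prs w).length = w.length := by
  simp [prs]

theorem prs_get {G : SimpleGraph V} {x y : V} (w : G.Walk x y) (i : ℕ) (hi : i < (prs w).length) :
    (prs w)[i] = (w.getVert i, w.getVert (i + 1)) := by
  simp [prs, SimpleGraph.Walk.darts_getElem_eq_getVert]

theorem prs_adj {G : SimpleGraph V} {x y : V} (w : G.Walk x y) (d : V × V) (hd : d ∈ prs w) : G.Adj d.1 d.2 := by
  simp only [prs, List.mem_map] at hd
  obtain ⟨e, -, rfl⟩ := hd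
  exact e.adj

theorem getVert_mod {G : SimpleGraph V} {x : V} (w : G.Walk x x) {i : ℕ} (hi : i < w.length) :
    w.getVert ((i + 1) % w.length) = w.getVert (i + 1) := by
  by_cases hh : i + 1 < w.length
  · rw [Nat.mod_eq_of_lt hh]
  · have : i + 1 = w.length := by omega
    rw [this, Nat.mod_self]; simp

theorem cyc_prs {G : SimpleGraph V} {x : V} (w : G.Walk x x) {r : V × V → V × V → Prop} :
    Cyc r (prs w) ↔ ∀ i < w.length,
      r (w.getVert ((i + w.length - 1) % w.length), w.getVert i) (w.getVert i, w.getVert ((i + 1) % w.length)) := by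
  rw [cyc_idx]
  have hlt : ∀ i, i < w.length → ∀ k, k % w.length < w.length := fun i hi k => Nat.mod_lt _ (by omega)
  have key : ∀ (i j : ℕ) (hi : i < (prs w).length) (hj : j < w.length)
      (hij : (i + 1) % w.length = j) (hji : (j + w.length - 1) % w.length = i),
      (r (prs w)[i] ((prs w)[(i + 1) % (prs w).length]'(Nat.mod_lt _ (by omega))) ↔
      r (w.getVert ((j + w.length - 1) % w.length), w.getVert j) (w.getVert j, w.getVert ((j + 1) % w.length))) := by
    intro i j hi hj hij hji
    have hi' : i < w.length := by rwa [prs_length] at hi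
    rw [prs_get, prs_get, hji, getVert_mod w hj, ← getVert_mod w hi']
    simp only [prs_length, hij]
  have pred : ∀ j, j < w.length → ∃ i, i < w.length ∧ (i + 1) % w.length = j ∧ (j + w.length - 1) % w.length = i := by
    intro j hj
    rcases j with _ | j
    · refine ⟨w.length - 1, by omega, ?_, ?_⟩
      · rw [Nat.sub_add_cancel (by omega), Nat.mod_self]
      · rw [zero_add, Nat.mod_eq_of_lt (by omega)]
    · refine ⟨j, by omega, Nat.mod_eq_of_lt hj, ?_⟩
      rw [show j + 1 + w.length - 1 = j + w.length by omega, Nat.add_mod_right, Nat.mod_eq_of_lt (by omega)]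
  constructor
  · intro h j hj
    obtain ⟨i, hi, h1, h2⟩ := pred j hj
    exact (key i j (by rwa [prs_length]) hj h1 h2).1 (h i (by rwa [prs_length]))
  · intro h i hi
    have hi' : i < w.length := by rwa [prs_length] at hi
    have hj := hlt i hi' (i + 1)
    refine (key i ((i + 1) % w.length) hi hj rfl ?_).2 (h _ hj)
    obtain ⟨i', hi1, h1, h2⟩ := pred _ hj
    rw [h2]
    by_cases c1 : i + 1 < w.length
    · by_cases c2 : i' + 1 < w.length
      · rw [Nat.mod_eq_of_lt c1, Nat.mod_eq_of_lt c2] at h1; omega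
      · have c2 : i' + 1 = w.length := by omega
        rw [Nat.mod_eq_of_lt c1, c2, Nat.mod_self] at h1; omega
    · have c1 : i + 1 = w.length := by omega
      by_cases c2 : i' + 1 < w.length
      · rw [Nat.mod_eq_of_lt c2, c1, Nat.mod_self] at h1; omega
      · omega

theorem cyc_mem {α : Type*} {L : List α} : Cyc (fun d d' => d ∈ L ∧ d' ∈ L) L := by
  rw [cyc_idx]
  intro i hi
  exact ⟨List.getElem_mem _, List.getElem_mem _⟩

theorem OF_of_trace [DecidableEq V] {G : SimpleGraph V} {x : V} (w : G.Walk x x) (hs : IsStrongTrace w)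
    (ha : IsAntiparallel w) : OF (prs w) ∧ ∀ a b, G.Adj a b ↔ (a, b) ∈ prs w := by
  have hcount : ∀ a b, G.Adj a b → (prs w).count (a, b) = 1 := fun a b hab => (ha a b hab).1
  have hmem : ∀ a b, G.Adj a b ↔ (a, b) ∈ prs w := by
    intro a b
    constructor
    · intro hab
      rw [← List.count_pos_iff, hcount a b hab]; exact one_pos
    · exact fun h => prs_adj w _ h
  refine ⟨⟨?_, ?_, ?_, ?_, ?_⟩, hmem⟩
  · rw [List.nodup_iff_count_le_one]
    rintro ⟨a, b⟩
    by_cases hab : G.Adj a b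
    · exact (hcount a b hab).le
    · rw [List.count_eq_zero_of_not_mem]
      · exact zero_le_one
      · rwa [← hmem]
  · exact fun d hd => (prs_adj w d hd).ne
  · rintro ⟨a, b⟩ hd
    exact (hmem _ _).1 (prs_adj w _ hd).symm
  · rw [cyc_prs]; intro i _; rfl
  · intro N hN
    rw [cyc_prs] at hN
    have hcm := (cyc_prs w).1 (cyc_mem (L := prs w))
    suffices key : ∀ d ∈ prs w, ∀ d' ∈ prs w, d.1 = d'.1 → N d → N d' from
      fun d hd d' hd' hdd => ⟨key d hd d' hd' hdd, key d' hd' d hd hdd.symm⟩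
    rintro ⟨v, b⟩ hd ⟨v', b'⟩ hd' hdd hNd
    simp only at hdd
    subst hdd
    by_contra hNd'
    refine hs.2 v {c | G.Adj v c ∧ N (v, c)} (fun c hc => hc.1) ⟨b, prs_adj w _ hd, hNd⟩ ?_ ?_
    · intro heq
      have : b' ∈ {c | G.Adj v c ∧ N (v, c)} := by
        rw [heq]; exact prs_adj w _ hd'
      exact hNd' this.2
    · intro i hi hv
      have h1 := hN i hi
      have h2 := hcm i hi
      simp only [Prod.swap_prod_mk, hv] at h1 h2
      have h3 := (prs_adj w _ h2.1).symm
      have h4 := prs_adj w _ h2.2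
      simp only at h3 h4
      constructor
      · rintro ⟨-, h5⟩
        exact ⟨h4, h1.1 h5⟩
      · rintro ⟨-, h5⟩
        exact ⟨h3, h1.2 h5⟩

theorem walk_of_chain {G : SimpleGraph V} {x : V × V} {l : List (V × V)} : ∀ {a : V × V},
    List.IsChain (fun d d' : V × V => d.2 = d'.1) (a :: (l ++ [x])) →
    (∀ z ∈ a :: l, G.Adj z.1 z.2) → ∃ w : G.Walk a.1 x.1, prs w = a :: l := by
  induction l with
  | nil =>
    intro a h hG
    simp at h
    have hadj : G.Adj a.1 x.1 := h ▸ hG a (by simp)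
    refine ⟨Walk.cons hadj Walk.nil, ?_⟩
    simp [prs, ← h]
  | cons b l ih =>
    intro a h hG
    simp only [List.cons_append, List.isChain_cons_cons] at h
    obtain ⟨w, hw⟩ := ih h.2 (fun z hz => hG z (List.mem_cons_of_mem _ hz))
    have hadj : G.Adj a.1 b.1 := h.1 ▸ hG a (by simp)
    refine ⟨Walk.cons hadj w, ?_⟩
    simp only [prs] at hw
    simp [prs, hw, ← h.1]

theorem count_mk [DecidableEq V] {a b : V} (hab : a ≠ b) (L : List (V × V)) :
    (L.map (fun d => s(d.1, d.2))).count s(a, b) = L.count (a, b) + L.count (b, a) := by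
  induction L with
  | nil => simp
  | cons d L ih =>
    obtain ⟨p, q⟩ := d
    simp only [List.map_cons, List.count_cons, ih, beq_iff_eq, Sym2.eq_iff, Prod.mk.injEq]
    by_cases h1 : p = a ∧ q = b
    · have : ¬ (p = b ∧ q = a) := by
        rintro ⟨rfl, -⟩; exact hab h1.1.symm
      simp [h1, this, hab]; omega
    · by_cases h2 : p = b ∧ q = a
      · simp [h2, hab, hab.symm]; omega
      · simp [h1, h2]

theorem trace_of_OF [DecidableEq V] {G : SimpleGraph V} (hG : G.Connected) {L : List (V × V)} (h : OF L)
    (hL : ∀ a b, G.Adj a b ↔ (a, b) ∈ L) :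
    ∃ (x : V) (w : G.Walk x x), IsStrongTrace w ∧ IsAntiparallel w := by
  obtain ⟨x, w, hw⟩ : ∃ (x : V) (w : G.Walk x x), prs w = L := by
    rcases L with _ | ⟨a, l⟩
    · obtain ⟨x⟩ := hG.nonempty
      exact ⟨x, Walk.nil, rfl⟩
    · obtain ⟨w, hw⟩ := walk_of_chain h.walk (fun z hz => (hL _ _).2 hz)
      exact ⟨_, w, hw⟩
  subst hw
  have hcount : ∀ a b, G.Adj a b → (prs w).count (a, b) = 1 :=
    fun a b hab => List.count_eq_one_of_mem h.nodup ((hL a b).1 hab)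
  refine ⟨x, w, ⟨?_, ?_⟩, fun a b hab => ⟨hcount a b hab, hcount b a hab.symm⟩⟩
  · intro e he
    induction e using Sym2.ind with
    | _ a b =>
      rw [mem_edgeSet] at he
      have : w.edges = (prs w).map (fun d => s(d.1, d.2)) := by
        simp only [prs, Walk.edges, List.map_map]
        rfl
      rw [this, count_mk he.ne, hcount a b he, hcount b a he.symm]
  · intro v N hN hne hneq hrep
    apply hneq
    refine Set.Subset.antisymm hN ?_
    obtain ⟨b, hb⟩ := hne
    intro c hc
    have key := h.strong (fun d => d.1 = v ∧ d.2 ∈ N) (by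
      rw [cyc_prs]
      intro i hi
      have := hrep i hi
      simp only [Prod.swap_prod_mk]
      tauto) (v, b) ((hL _ _).1 (hN hb)) (v, c) ((hL _ _).1 hc) rfl
    exact (key.1 ⟨rfl, hb⟩).2

end OFT

/-- A finite connected simple graph admits an antiparallel strong trace iff it has a spanning
tree all of whose co-tree components have an even number of edges. -/
theorem exists_antiparallel_strong_trace_iff {V : Type*} [Fintype V] [DecidableEq V]
    (G : SimpleGraph V) (hG : G.Connected) :
    (∃ (x : V) (w : G.Walk x x), IsStrongTrace w ∧ IsAntiparallel w) ↔
      ∃ T : SimpleGraph V, IsSpanningTree G T ∧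
        ∀ C : (G \ T).ConnectedComponent, Even (componentEdgeCount (G \ T) C) := by
  constructor
  · rintro ⟨x, w, hs, ha⟩
    obtain ⟨h1, h2⟩ := OFT.OF_of_trace w hs ha
    obtain ⟨T, hT, hc, hac, hg⟩ := OFT.spanning_of_OF hG h1 h2
    refine ⟨T, ⟨hT, hc, hac⟩, fun C => OFT.good_even hg C.supp ?_⟩
    intro a b hab
    rw [ConnectedComponent.mem_supp_iff, ConnectedComponent.mem_supp_iff,
      ConnectedComponent.sound hab.reachable]
  · rintro ⟨T, ⟨hT, hc, hac⟩, hC⟩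
    obtain ⟨L, h1, h2⟩ := OFT.good_OF hc hac (OFT.even_good hC) (fun a b hab => hab.2)
    refine OFT.trace_of_OF hG h1 fun a b => ?_
    rw [h2]
    simp only [sdiff_adj]
    constructor
    · intro h; by_cases hh : T.Adj a b <;> simp [h, hh]
    · rintro (h | h)
      · exact hT h
      · exact h.1
end

section
/- A finite connected simple graph G admits a parallel strong trace if and only if G is Eulerian, that is, every vertex of G has even degree. -/
open SimpleGraph

section fwd
variable {V : Type*} [Fintype V] [DecidableEq V] {G : SimpleGraph V}

lemma trav_cons {x y z : V} (h : G.Adj x y) (p : G.Walk y z) (a b : V) :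
    traversals (Walk.cons h p) a b = traversals p a b + if x = a ∧ y = b then 1 else 0 := by
  simp [traversals, List.count_cons]

lemma trav_balance {x y : V} (w : G.Walk x y) (a : V) :
    (∑ b, traversals w a b) + (if y = a then 1 else 0) =
      (∑ b, traversals w b a) + (if x = a then 1 else 0) := by
  induction w with
  | nil => simp [traversals]
  | @cons x y z h p ih =>
    simp only [trav_cons, Finset.sum_add_distrib]
    have h1 : (∑ b, if x = a ∧ y = b then 1 else 0) = if x = a then 1 else 0 := by
      by_cases hx : x = a <;> simp [hx]
    have h2 : (∑ b, if x = b ∧ y = a then 1 else 0) = if y = a then 1 else 0 := by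
      by_cases hx : y = a <;> simp [hx]
    rw [h1, h2]
    omega

lemma trav_nonadj {x y : V} (w : G.Walk x y) (a b : V) (h : ¬ G.Adj a b) :
    traversals w a b = 0 := by
  rw [traversals, List.count_eq_zero]
  intro hm
  rw [List.mem_map] at hm
  obtain ⟨d, _, hd⟩ := hm
  apply h
  have := d.adj
  rw [hd] at this
  exact this

lemma fwd_dir [DecidableRel G.Adj] {x : V} (w : G.Walk x x) (hp : IsParallel w) (v : V) :
    Even (G.degree v) := by
  have hb := trav_balance w v
  have hb' : (∑ b, traversals w v b) = ∑ b, traversals w b v := by omega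
  have h2 : 2 * G.degree v = ∑ b, (traversals w v b + traversals w b v) := by
    have : ∀ b, traversals w v b + traversals w b v = if G.Adj v b then 2 else 0 := by
      intro b
      split_ifs with h
      · have := hp v b h
        omega
      · rw [trav_nonadj w v b h, trav_nonadj w b v (fun h' => h h'.symm)]
    simp_rw [this]
    rw [← Finset.sum_filter, Finset.sum_const, ← G.card_neighborFinset_eq_degree,
      G.neighborFinset_eq_filter]
    simp [mul_comm]
  rw [Finset.sum_add_distrib, ← hb'] at h2
  have h3 : G.degree v = ∑ b, traversals w v b := by omega
  rw [h3]
  apply Finset.even_sum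
  intro b _
  by_cases h : G.Adj v b
  · rcases hp v b h with h | h <;> rw [h.1] <;> decide
  · rw [trav_nonadj w v b h]; decide
end fwd

section perms
open Equiv

lemma exists_fpf (α : Type*) [Fintype α] (h : Even (Fintype.card α)) :
    ∃ f : α → α, (∀ x, f (f x) = x) ∧ ∀ x, f x ≠ x := by
  obtain ⟨k, hk⟩ := h
  have e : α ≃ Fin k × Bool := Fintype.equivOfCardEq (by simp [hk]; omega)
  refine ⟨fun x => e.symm ((e x).1, !(e x).2), fun x => by simp, fun x hx => ?_⟩
  have := congrArg (fun y => (e y).2) hx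
  simp at this

lemma merge {X : Type*} [Finite X] [DecidableEq X] (S : Perm X) (x y : X)
    (h : ¬ S.SameCycle x y) :
    (S * swap x y).SameCycle x y ∧
      ∀ p q, S.SameCycle p q → (S * swap x y).SameCycle p q := by
  set T := S * swap x y with hT
  have hTx : T x = S y := by simp [hT]
  have hTy : T y = S x := by simp [hT]
  have hTz : ∀ z, z ≠ x → z ≠ y → T z = S z := by
    intro z h1 h2
    simp [hT, swap_apply_of_ne_of_ne h1 h2]
  have key : ∀ k : ℕ, T.SameCycle y ((S ^ (k+1)) x) := by
    intro k
    induction k with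
    | zero => rw [zero_add, pow_one, ← hTy]; exact ⟨1, by simp⟩
    | succ k ih =>
      rw [pow_succ', Perm.mul_apply]
      by_cases h1 : (S ^ (k+1)) x = x
      · rw [h1, ← hTy]; exact ⟨1, by simp⟩
      · rw [← hTz _ h1 (fun h2 => h ⟨(k+1 : ℕ), by rw [zpow_natCast]; exact h2⟩)]
        exact ih.trans ⟨1, by simp⟩
  have hxy : T.SameCycle x y := by
    have h1 : 0 < orderOf S := orderOf_pos S
    have := key (orderOf S - 1)
    rw [Nat.sub_add_cancel h1, pow_orderOf_eq_one] at this
    exact this.symm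
  refine ⟨hxy, ?_⟩
  have st : ∀ p, T.SameCycle p (S p) := by
    intro p
    by_cases h1 : p = x
    · subst h1; rw [← hTy]; exact hxy.trans ⟨1, by simp⟩
    by_cases h2 : p = y
    · subst h2; rw [← hTx]; exact hxy.symm.trans ⟨1, by simp⟩
    rw [← hTz p h1 h2]; exact ⟨1, by simp⟩
  have st' : ∀ p, ∀ n : ℕ, T.SameCycle p ((S^n) p) := by
    intro p n
    induction n with
    | zero => exact ⟨0, by simp⟩
    | succ n ih => rw [pow_succ', Perm.mul_apply]; exact ih.trans (st _)
  intro p q hpq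
  obtain ⟨n, hn⟩ := hpq.exists_nat_pow_eq
  rw [← hn]; exact st' p n

lemma exists_fibre_cycle {A V : Type*} [Finite A] (h : A → V) :
    ∃ r : Perm A, (∀ a, h (r a) = h a) ∧
      ∀ a b, h a = h b → ∃ n : ℕ, (r ^ n) a = b := by
  classical
  have : Fintype A := Fintype.ofFinite A
  have hc : ∀ v, ∃ f : Perm A, f.IsCycleOn {a | h a = v} := by
    intro v
    obtain ⟨f, hf, -⟩ := (Finset.univ.filter (fun a => h a = v)).exists_cycleOn
    exact ⟨f, by simpa using hf⟩
  choose f hf using hc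
  have h1 : ∀ a, h (f (h a) a) = h a := fun a => (hf (h a)).1.mapsTo rfl
  have h2 : ∀ a, h ((f (h a)).symm a) = h a := fun a => (hf (h a)).inv.1.mapsTo rfl
  refine ⟨⟨fun a => f (h a) a, fun a => (f (h a)).symm a, fun a => by simp [h1], fun a => by simp [h2]⟩, h1, ?_⟩
  intro a b hab
  obtain ⟨n, hn⟩ := ((hf (h b)).2 hab rfl : (f (h b)).SameCycle a b).exists_nat_pow_eq
  refine ⟨n, ?_⟩
  rw [← hn]
  have : ∀ n : ℕ, h (((f (h b)) ^ n) a) = h b ∧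
    ((⟨fun a => f (h a) a, fun a => (f (h a)).symm a, fun a => by simp [h1], fun a => by simp [h2]⟩ : Perm A) ^ n) a
      = ((f (h b)) ^ n) a := by
    intro n
    induction n with
    | zero => simp [hab]
    | succ n ih =>
      rw [pow_succ', pow_succ', Perm.mul_apply, Perm.mul_apply, ih.2]
      refine ⟨?_, ?_⟩
      · have := h1 ((f (h b) ^ n) a); rwa [ih.1] at this
      · simp [ih.1]
  exact (this n).2

/-- the merged permutation -/
lemma exists_merged {A : Type*} [Finite A] [DecidableEq A] (s r : Perm A) :
    ∃ S : Perm (A × Bool), (∀ a, S.SameCycle (a, false) (a, true)) ∧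
      ∀ a, ∃ i, (S (a, i)).1 = s a ∧ (S (a, !i)).1 = s (r a) := by
  classical
  have : Fintype A := Fintype.ofFinite A
  let P : Perm (A × Bool) → Prop := fun S =>
    ∀ a, ∃ i, (S (a, i)).1 = s a ∧ (S (a, !i)).1 = s (r a)
  let m : Perm (A × Bool) → ℕ := fun S =>
    (Finset.univ.filter (fun p : (A × Bool) × (A × Bool) => S.SameCycle p.1 p.2)).card
  have hne : (Finset.univ.filter P).Nonempty := by
    refine ⟨⟨fun x => (bif x.2 then s (r x.1) else s x.1, x.2),
      fun x => (bif x.2 then r.symm (s.symm x.1) else s.symm x.1, x.2), ?_, ?_⟩, ?_⟩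
    · rintro ⟨a, i⟩; cases i <;> simp
    · rintro ⟨a, i⟩; cases i <;> simp
    · simp only [Finset.mem_filter, Finset.mem_univ, true_and]
      intro a
      exact ⟨false, by simp⟩
  obtain ⟨S, hS, hmax⟩ := Finset.exists_max_image _ m hne
  simp only [Finset.mem_filter, Finset.mem_univ, true_and] at hS hmax
  refine ⟨S, ?_, hS⟩
  · intro a
    by_contra hn
    obtain ⟨h1, h2⟩ := merge S _ _ hn
    have hP : P (S * swap (a, false) (a, true)) := by
      intro b
      by_cases hb : b = a
      · subst hb
        obtain ⟨i, hi⟩ := hS b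
        refine ⟨!i, ?_⟩
        cases i <;> simpa using hi
      · obtain ⟨i, hi⟩ := hS b
        refine ⟨i, ?_⟩
        rw [Perm.mul_apply, Perm.mul_apply, swap_apply_of_ne_of_ne, swap_apply_of_ne_of_ne]
        · exact hi
        all_goals simp [hb]
    have := hmax _ hP
    apply absurd this
    rw [not_le]
    apply Finset.card_lt_card
    rw [Finset.ssubset_iff_of_subset]
    · exact ⟨((a, false), (a, true)), by simpa using h1, by simpa using hn⟩
    · intro p hp
      simp only [Finset.mem_filter, Finset.mem_univ, true_and] at hp ⊢
      exact h2 _ _ hp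
end perms

section walks
variable {V : Type*} {G : SimpleGraph V}

/-- walk following a sequence of vertices -/
def walkOf (f : ℕ → V) (hf : ∀ i, G.Adj (f i) (f (i+1))) : (n : ℕ) → G.Walk (f 0) (f n)
  | 0 => Walk.nil
  | n+1 => (walkOf f hf n).concat (hf n)

lemma walkOf_length (f : ℕ → V) (hf : ∀ i, G.Adj (f i) (f (i+1))) (n : ℕ) :
    (walkOf f hf n).length = n := by
  induction n with
  | zero => rfl
  | succ n ih => rw [walkOf, Walk.length_concat, ih]

lemma walkOf_getVert (f : ℕ → V) (hf : ∀ i, G.Adj (f i) (f (i+1))) (n i : ℕ) (hi : i ≤ n) :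
    (walkOf f hf n).getVert i = f i := by
  induction n with
  | zero => obtain rfl : i = 0 := by omega
            simp
  | succ n ih =>
    rw [walkOf, Walk.concat_eq_append, Walk.getVert_append, walkOf_length]
    split_ifs with h
    · exact ih h.le
    · rcases (by omega : i = n ∨ i = n + 1) with rfl | rfl <;> simp

lemma walkOf_darts (f : ℕ → V) (hf : ∀ i, G.Adj (f i) (f (i+1))) (n : ℕ) :
    (walkOf f hf n).darts.map SimpleGraph.Dart.toProd =
      (List.range n).map (fun i => (f i, f (i+1))) := by
  induction n with
  | zero => rfl
  | succ n ih => rw [walkOf, Walk.darts_concat, List.range_succ]; simp [ih]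

lemma edges_count [DecidableEq V] {x y : V} (w : G.Walk x y) (a b : V) (h : G.Adj a b) :
    w.edges.count s(a, b) = traversals w a b + traversals w b a := by
  have hne := h.ne
  induction w with
  | nil => simp [traversals]
  | @cons x y z h' p ih =>
    have e1 : ∀ c d, traversals (Walk.cons h' p) c d =
        traversals p c d + if x = c ∧ y = d then 1 else 0 := by
      intro c d; simp [traversals, List.count_cons]
    rw [e1, e1, Walk.edges_cons, List.count_cons, ih]
    have : (s(x, y) == s(a, b)) = decide ((x = a ∧ y = b) ∨ (x = b ∧ y = a)) := by
      rw [Bool.eq_iff_iff]; simp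
    rw [this]
    by_cases h1 : x = a ∧ y = b
    · obtain ⟨rfl, rfl⟩ := h1
      simp [hne]; omega
    · by_cases h2 : x = b ∧ y = a
      · obtain ⟨rfl, rfl⟩ := h2
        simp [hne]; omega
      · simp [h1, h2]
end walks

section orient
open Equiv
variable {V : Type*} [Fintype V] [DecidableEq V]

lemma exists_orient (G : SimpleGraph V) [DecidableRel G.Adj] (he : ∀ v, Even (G.degree v)) :
    ∃ (s : Perm G.Dart) (O : Set G.Dart), (∀ d, (s d).fst = d.snd) ∧ (∀ d, s d ∈ O ↔ d ∈ O) ∧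
      ∀ d, d ∈ O ↔ d.symm ∉ O := by
  have h1 : ∀ v, ∃ f : G.neighborSet v → G.neighborSet v, (∀ x, f (f x) = x) ∧ ∀ x, f x ≠ x := by
    intro v
    apply exists_fpf
    rw [G.card_neighborSet_eq_degree]; exact he v
  choose f hf hf' using h1
  let π : G.Dart → G.Dart := fun d => ⟨(d.fst, (f d.fst ⟨d.snd, d.adj⟩ : V)), (f d.fst ⟨d.snd, d.adj⟩).2⟩
  have hπ : ∀ d, π (π d) = d := by
    intro d
    apply Dart.ext
    simp only [π]
    rw [hf]
  have hπ' : ∀ d, π d ≠ d := by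
    intro d hd
    have : (π d).snd = d.snd := by rw [hd]
    exact hf' d.fst ⟨d.snd, d.adj⟩ (Subtype.ext this)
  let s : Perm G.Dart := ⟨fun d => π d.symm, fun d => (π d).symm, fun d => by simp [hπ],
    fun d => by simp [hπ]⟩
  have hs : ∀ d, s d = π d.symm := fun _ => rfl
  have hs' : ∀ d, s (s d).symm = d.symm := by
    intro d; rw [hs, hs, Dart.symm_symm, hπ]
  have hpow : ∀ (n : ℕ) d, (s ^ n) ((s ^ n) d).symm = d.symm := by
    intro n
    induction n with
    | zero => simp
    | succ n ih =>
      intro d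
      have e1 : (s ^ (n+1)) d = s ((s ^ n) d) := by rw [pow_succ', Perm.mul_apply]
      rw [e1, pow_succ, Perm.mul_apply, hs', ih]
  have hno : ∀ d, ¬ s.SameCycle d d.symm := by
    intro d hd
    obtain ⟨n, hn⟩ := hd.exists_nat_pow_eq
    obtain ⟨k, rfl | rfl⟩ := Nat.even_or_odd' n
    · have h2 := hpow k d
      rw [← hn, two_mul, pow_add, Perm.mul_apply] at h2
      exact Dart.symm_ne _ ((s ^ k).injective h2)
    · have h2 := hpow k d
      rw [← hn, two_mul, add_assoc, pow_add, Perm.mul_apply, pow_succ', Perm.mul_apply] at h2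
      exact hπ' _ ((s ^ k).injective h2).symm
  let Q := Quotient (Perm.SameCycle.setoid s)
  let q : G.Dart → Q := Quotient.mk _
  have hq : ∀ d e, q d = q e ↔ s.SameCycle d e := fun d e => Quotient.eq
  let _ : LinearOrder Q := by classical exact linearOrderOfSTO WellOrderingRel
  have hqs : ∀ d, q (s d) = q d := fun d => (hq _ _).2 (Perm.SameCycle.symm ⟨1, by simp⟩)
  refine ⟨s, {d | q d < q d.symm}, fun _ => rfl, ?_, ?_⟩
  · intro d
    have : q (s d).symm = q d.symm := by rw [← hqs, hs']
    simp only [Set.mem_ofPred_eq]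
    rw [this, hqs]
  · intro d
    have := mt (hq _ _).1 (hno d)
    simp only [Set.mem_ofPred_eq, Dart.symm_symm, not_lt]
    exact ⟨le_of_lt, fun h => lt_of_le_of_ne h this⟩

end orient

section bwd
open Equiv
variable {V : Type*} [Fintype V] [DecidableEq V]

/-- the single-cycle permutation -/
lemma exists_single {A : Type*} [Finite A] (G : SimpleGraph V) (hG : G.Connected)
    (t h : A → V) (s r : Perm A) (hst : ∀ a, t (s a) = h a)
    (hadj : ∀ u v, G.Adj u v → ∃ a, (t a = u ∧ h a = v) ∨ (t a = v ∧ h a = u))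
    (hrh : ∀ a, h (r a) = h a) (hr : ∀ a b, h a = h b → ∃ n : ℕ, (r ^ n) a = b) :
    ∃ S : Perm (A × Bool), (∀ x y, S.SameCycle x y) ∧ (∀ x, t (S x).1 = h x.1) ∧
      ∀ a, ∃ i j, (S (a, i)).1 = s a ∧ (S (a, j)).1 = s (r a) := by
  classical
  obtain ⟨S, hS1, hS2⟩ := exists_merged s r
  let R : A → A → Prop := fun a b => S.SameCycle (a, false) (b, false)
  have hall : ∀ a i j, S.SameCycle (a, i) (a, j) := by
    intro a i j
    have h1 := hS1 a
    cases i <;> cases j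
    · exact Perm.SameCycle.refl _ _
    · exact h1
    · exact h1.symm
    · exact Perm.SameCycle.refl _ _
  have hR : ∀ a b i j, R a b → S.SameCycle (a, i) (b, j) := fun a b i j hab =>
    ((hall a i false).trans hab).trans (hall b false j)
  have hR' : ∀ a i, R a (S (a, i)).1 := fun a i =>
    ((hall a false i).trans (⟨1, by simp⟩ : S.SameCycle (a, i) (S (a, i)))).trans
      (hall (S (a, i)).1 (S (a, i)).2 false)
  have hRs : ∀ a, R a (s a) ∧ R a (s (r a)) := by
    intro a
    obtain ⟨i, h1, h2⟩ := hS2 a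
    rw [← h1, ← h2]
    exact ⟨hR' _ _, hR' _ _⟩
  have hRr : ∀ a, R a (r a) := fun a => (hRs a).2.trans (hRs (r a)).1.symm
  have hRp : ∀ a (n : ℕ), R a ((r ^ n) a) := by
    intro a n
    induction n with
    | zero => exact Perm.SameCycle.refl _ _
    | succ n ih => rw [pow_succ', Perm.mul_apply]; exact ih.trans (hRr _)
  have hRh : ∀ a b, h a = h b → R a b := by
    intro a b hab
    obtain ⟨n, rfl⟩ := hr a b hab
    exact hRp a n
  have hRth : ∀ a b, t a = h b → R a b := by
    intro a b hab
    have e : h (s.symm a) = h b := by rw [← hst, apply_symm_apply, hab]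
    have := (hRs (s.symm a)).1
    rw [apply_symm_apply] at this
    exact this.symm.trans (hRh _ _ e)
  have hRtt : ∀ a b, t a = t b → R a b := by
    intro a b hab
    have e : t a = h (s.symm b) := by rw [← hst, apply_symm_apply, hab]
    have := (hRs (s.symm b)).1
    rw [apply_symm_apply] at this
    exact (hRth _ _ e).trans this
  have hinc : ∀ v a b, (h a = v ∨ t a = v) → (h b = v ∨ t b = v) → R a b := by
    rintro v a b (h1 | h1) (h2 | h2)
    · exact hRh _ _ (h1.trans h2.symm)
    · exact (hRth _ _ (h2.trans h1.symm)).symm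
    · exact hRth _ _ (h1.trans h2.symm)
    · exact hRtt _ _ (h1.trans h2.symm)
  have hconn : ∀ u v (p : G.Walk u v), ∀ a b, (h a = u ∨ t a = u) → (h b = v ∨ t b = v) →
      R a b := by
    intro u v p
    induction p with
    | nil => exact fun a b => hinc _ a b
    | @cons u m v hum p ih =>
      intro a b ha hb
      obtain ⟨c, ⟨h1, h2⟩ | ⟨h1, h2⟩⟩ := hadj u m hum
      · exact (hinc u a c ha (Or.inr h1)).trans (ih c b (Or.inl h2) hb)
      · exact (hinc u a c ha (Or.inl h2)).trans (ih c b (Or.inr h1) hb)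
  refine ⟨S, ?_, ?_, fun a => ?_⟩
  · rintro ⟨a, i⟩ ⟨b, j⟩
    obtain ⟨p⟩ := hG.preconnected (h a) (h b)
    exact hR _ _ _ _ (hconn _ _ p a b (Or.inl rfl) (Or.inl rfl))
  · rintro ⟨a, i⟩
    obtain ⟨j, h1, h2⟩ := hS2 a
    by_cases hij : i = j
    · subst hij; rw [h1, hst]
    · have : i = !j := by cases i <;> cases j <;> simp_all
      rw [this, h2, hst, hrh]
  · obtain ⟨i, hi⟩ := hS2 a
    exact ⟨i, !i, hi⟩

set_option maxHeartbeats 1000000 in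
lemma bwd_dir (G : SimpleGraph V) [DecidableRel G.Adj] (hG : G.Connected)
    (he : ∀ v, Even (G.degree v)) :
    ∃ (x : V) (w : G.Walk x x), IsStrongTrace w ∧ IsParallel w := by
  classical
  obtain ⟨s0, O, h0, hO, hOs⟩ := exists_orient G he
  let A := {d // d ∈ O}
  let s : Perm A := s0.subtypePerm hO
  let t : A → V := fun a => a.1.fst
  let h : A → V := fun a => a.1.snd
  have hst : ∀ a, t (s a) = h a := fun a => h0 a.1
  have hadj : ∀ u v, G.Adj u v → ∃ a, (t a = u ∧ h a = v) ∨ (t a = v ∧ h a = u) := by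
    intro u v huv
    by_cases hd : (⟨(u, v), huv⟩ : G.Dart) ∈ O
    · exact ⟨⟨_, hd⟩, Or.inl ⟨rfl, rfl⟩⟩
    · have := (hOs (⟨(u, v), huv⟩ : G.Dart).symm).2 (by simpa using hd)
      exact ⟨⟨_, this⟩, Or.inr ⟨rfl, rfl⟩⟩
  obtain ⟨r, hrh, hr⟩ := exists_fibre_cycle h
  obtain ⟨S, hS, hSt, hSs⟩ := exists_single G hG t h s r hst hadj hrh hr
  by_cases hA : IsEmpty A
  · obtain ⟨x⟩ := hG.nonempty
    have hn : ∀ u v, ¬ G.Adj u v := fun u v huv => by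
      obtain ⟨a, _⟩ := hadj u v huv
      exact hA.false a
    refine ⟨x, Walk.nil, ⟨?_, ?_⟩, fun a b hab => absurd hab (hn a b)⟩
    · intro e
      induction e with
      | _ a b => intro hab; exact absurd hab (hn a b)
    · intro v N hN ⟨u, hu⟩
      exact absurd (hN hu) (hn v u)
  obtain ⟨a0⟩ := not_isEmpty_iff.1 hA
  let x0 : A × Bool := (a0, false)
  have hsupp : x0 ∈ S.support := by
    rw [Perm.mem_support]
    intro hfix
    obtain ⟨n, hn⟩ := (hS x0 (a0, true))
    rw [Perm.zpow_apply_eq_self_of_apply_eq_self hfix] at hn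
    simp [x0] at hn
  let L := S.toList x0
  let n := L.length
  have hnpos : 0 < n := Perm.length_toList_pos_of_mem_support _ _ hsupp
  have hLn : L.Nodup := Perm.nodup_toList S x0
  have hLm : ∀ x, x ∈ L := fun x => Perm.mem_toList_iff.2 ⟨hS _ _, hsupp⟩
  have hLr : L = (List.range n).map (fun i => (S ^ i) x0) := by
    apply List.ext_getElem
    · simp [n]
    · intro i h1 h2
      simp [L, Perm.getElem_toList]
  have hSn : (S ^ n) x0 = x0 := by
    obtain ⟨i, hi, hx⟩ := List.getElem_of_mem (hLm (S.symm x0))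
    have hx' : (S ^ i) x0 = S.symm x0 := by rw [← hx]; simp [L, Perm.getElem_toList]
    have h1 : (S ^ (i+1)) x0 = x0 := by rw [pow_succ', Perm.mul_apply, hx']; simp
    by_cases h2 : i + 1 < n
    · have := (List.Nodup.getElem_inj_iff hLn (i := i + 1) (j := 0) (hi := h2) (hj := hnpos)).1
        (by simp [L, Perm.getElem_toList] at h1 ⊢; exact h1)
      omega
    · have : i + 1 = n := by
        have : i < n := hi
        omega
      rw [← this, h1]
  have hex : ∀ x, ∃ i < n, (S ^ i) x0 = x := by
    intro x
    have := hLm x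
    rw [hLr] at this
    simpa using this
  let f : ℕ → V := fun i => t ((S ^ i) x0).1
  have hf1 : ∀ i, f (i+1) = h ((S ^ i) x0).1 := by
    intro i
    simp only [f]
    rw [pow_succ', Perm.mul_apply, hSt]
  have hf : ∀ i, G.Adj (f i) (f (i+1)) := by
    intro i; rw [hf1]; exact ((S ^ i) x0).1.1.adj
  have hfn : f n = f 0 := by simp only [f]; rw [hSn]; simp
  let w : G.Walk (f 0) (f 0) := (walkOf f hf n).copy rfl hfn
  have hwl : w.length = n := by simp [w, walkOf_length]
  have hwg : ∀ i ≤ n, w.getVert i = f i := by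
    intro i hi; simp [w, walkOf_getVert f hf n i hi]
  have hwd : w.darts.map SimpleGraph.Dart.toProd = L.map (fun x => x.1.1.toProd) := by
    simp only [w, Walk.darts_copy]
    rw [walkOf_darts, hLr, List.map_map]
    apply List.map_congr_left
    intro i _
    rw [hf1]; rfl
  have htr : ∀ a b, traversals w a b =
      (Finset.univ.filter (fun x : A × Bool => x.1.1.toProd = (a, b))).card := by
    intro a b
    rw [traversals, hwd, List.count, List.countP_map]
    have hLf : L.toFinset = Finset.univ := by ext x; simp [hLm]
    rw [← hLf, List.countP_eq_length_filter, ← List.toFinset_card_of_nodup (hLn.filter _),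
      List.toFinset_filter]
    congr 1
    ext x; simp
  clear_value w
  have htr2 : ∀ d : G.Dart, d ∈ O → traversals w d.fst d.snd = 2 ∧ traversals w d.snd d.fst = 0 := by
    intro d hd
    rw [htr, htr]
    constructor
    · have : (Finset.univ.filter (fun x : A × Bool => x.1.1.toProd = (d.fst, d.snd))) =
          {((⟨d, hd⟩ : A), false), ((⟨d, hd⟩ : A), true)} := by
        ext ⟨⟨e, he⟩, i⟩
        have : e.toProd = (d.fst, d.snd) ↔ e = d := ⟨fun h => Dart.ext _ _ h, fun h => by rw [h]⟩
        cases i <;> simp [this, A]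
      rw [this]; simp
    · rw [Finset.card_eq_zero, Finset.filter_eq_empty_iff]
      rintro ⟨⟨e, he⟩, i⟩ - hx
      have : e = d.symm := Dart.ext _ _ hx
      subst this
      exact (hOs d).1 hd he
  have hpar : IsParallel w := by
    intro a b hab
    by_cases hd : (⟨(a, b), hab⟩ : G.Dart) ∈ O
    · exact Or.inl (htr2 _ hd)
    · have := (hOs (⟨(a, b), hab⟩ : G.Dart).symm).2 (by simpa using hd)
      exact Or.inr (htr2 _ this).symm
  refine ⟨f 0, w, ⟨?_, ?_⟩, hpar⟩
  · intro e
    induction e with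
    | _ a b =>
      intro hab
      rw [edges_count w a b hab]
      have := hpar a b hab
      omega
  · intro v N hN hNe hNp hrep
    have k1 : ∀ x : A × Bool, h x.1 = v → (t x.1 ∈ N ↔ h (S x).1 ∈ N) := by
      intro x hx
      obtain ⟨i, hi, rfl⟩ := hex x
      rcases (by omega : i + 1 < n ∨ i + 1 = n) with hi' | hi'
      · have := hrep (i+1) (by omega) (by rw [hwg _ hi'.le, hf1, hx])
        have e1 : (i + 1 + w.length - 1) % w.length = i := by
          rw [hwl, show i + 1 + n - 1 = i + n by omega, Nat.add_mod_right, Nat.mod_eq_of_lt hi]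
        rw [e1, hwl, hwg i hi.le] at this
        have e2 : w.getVert ((i + 1 + 1) % n) = h (S ((S ^ i) x0)).1 := by
          rw [← Perm.mul_apply, ← pow_succ', ← hf1]
          rcases (by omega : i + 1 + 1 < n ∨ i + 1 + 1 = n) with h3 | h3
          · rw [Nat.mod_eq_of_lt h3, hwg _ h3.le]
          · rw [h3, Nat.mod_self, hwg 0 (by omega), hfn]
        rw [e2] at this
        exact this
      · have hf0 : f 0 = v := by rw [← hfn, ← hi', hf1, hx]
        have := hrep 0 (by omega) (by rw [hwg _ (by omega), hf0])
        have e1 : (0 + w.length - 1) % w.length = i := by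
          rw [hwl, show 0 + n - 1 = i by omega, Nat.mod_eq_of_lt hi]
        rw [e1, hwl, hwg i hi.le] at this
        have e2 : w.getVert ((0 + 1) % n) = h (S ((S ^ i) x0)).1 := by
          rw [← Perm.mul_apply, ← pow_succ', hi', hSn]
          have : f 1 = h x0.1 := by simpa using hf1 0
          rw [← this]
          rcases (by omega : 0 + 1 < n ∨ 0 + 1 = n) with h3 | h3
          · rw [Nat.mod_eq_of_lt h3, hwg _ h3.le]
          · rw [h3, Nat.mod_self, hwg 0 (by omega), ← hfn, ← h3]
        rw [e2] at this
        exact this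
    have k2 : ∀ a, h a = v → (t a ∈ N ↔ h (s a) ∈ N) ∧ (t a ∈ N ↔ h (s (r a)) ∈ N) := by
      intro a ha
      obtain ⟨i, j, hi, hj⟩ := hSs a
      rw [← hi, ← hj]
      exact ⟨k1 (a, i) ha, k1 (a, j) ha⟩
    have k3 : ∀ a, h a = v → ∀ m : ℕ, h ((r ^ m) a) = v ∧ (t a ∈ N ↔ t ((r ^ m) a) ∈ N) := by
      intro a ha m
      induction m with
      | zero => simp [ha]
      | succ m ih =>
        rw [pow_succ', Perm.mul_apply]
        have e := (hrh ((r ^ m) a)).trans ih.1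
        exact ⟨e, ih.2.trans ((k2 _ ih.1).2.trans (k2 _ e).1.symm)⟩
    have k4 : ∀ a b, h a = v → h b = v → (t a ∈ N ↔ t b ∈ N) := by
      intro a b ha hb
      obtain ⟨m, rfl⟩ := hr a b (ha.trans hb.symm)
      exact (k3 a ha m).2
    have k5 : ∀ u, G.Adj v u → ∃ a, h a = v ∧ (u ∈ N ↔ t a ∈ N) := by
      intro u hu
      obtain ⟨a, ⟨h1, h2⟩ | ⟨h1, h2⟩⟩ := hadj v u hu
      · have e : h (s.symm a) = v := by rw [← hst, apply_symm_apply, h1]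
        refine ⟨s.symm a, e, ?_⟩
        rw [(k2 _ e).1, apply_symm_apply, h2]
      · exact ⟨a, h2, by rw [h1]⟩
    obtain ⟨u, hu⟩ := hNe
    apply hNp
    apply Set.Subset.antisymm hN
    intro u' hu'
    obtain ⟨a, ha, ha'⟩ := k5 u (hN hu)
    obtain ⟨b, hb, hb'⟩ := k5 u' hu'
    exact hb'.2 ((k4 a b ha hb).1 (ha'.1 hu))
end bwd

/-- A finite connected simple graph admits a parallel strong trace iff it is Eulerian, i.e.
every vertex has even degree. -/
theorem exists_parallel_strong_trace_iff {V : Type*} [Fintype V] [DecidableEq V]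
    (G : SimpleGraph V) [DecidableRel G.Adj] (hG : G.Connected) :
    (∃ (x : V) (w : G.Walk x x), IsStrongTrace w ∧ IsParallel w) ↔
      ∀ v : V, Even (G.degree v) := by
  constructor
  · rintro ⟨x, w, -, hp⟩ v
    exact fwd_dir w hp v
  · exact bwd_dir G hG
end

section
/- Let G be a finite simple graph, W a double trace of G, and v a vertex of G such that W has two disjoint nontrivial repetitions at v, i.e. there are disjoint sets N_1 and N_2 of neighbours of v, each nonempty and each a proper subset of N(v), such that W has an N_1-repetition and an N_2-repetition at v. Suppose moreover that some edge e = uv with u in N_1 is traversed by W twice in the same direction. Then there exists a double trace W' of G which traverses every edge of G in the same directions as W (for every ordered pair of adjacent vertices (x,y), W' traverses the edge xy from x to y the same number of times as W does) and such that the number of sets N of neighbours of v forming a nontrivial N-repetition of W' at v is strictly smaller than the number of sets N of neighbours of v forming a nontrivial N-repetition of W at v, and the total number over all vertices of sets forming nontrivial repetitions of W' is strictly smaller than that of W. -/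
open SimpleGraph

/-- predecessor in cyclic order -/
def prv {V : Type*} (f : ℕ → V) (n i : ℕ) : V := f (if i = 0 then n - 1 else i - 1)

lemma hasRep_iff {V : Type*} {G : SimpleGraph V} {x : V} (w : G.Walk x x) (v : V) (N : Set V) :
    HasRepetition w v N ↔ ∀ i < w.length, w.getVert i = v →
      (prv w.getVert w.length i ∈ N ↔ w.getVert (i + 1) ∈ N) := by
  unfold HasRepetition prv
  refine forall_congr' fun i => forall_congr' fun hi => forall_congr' fun _ => ?_
  have h1 : (i + w.length - 1) % w.length = if i = 0 then w.length - 1 else i - 1 := by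
    split_ifs with h
    · subst h
      rw [Nat.mod_eq_of_lt] <;> omega
    · rw [show i + w.length - 1 = (i - 1) + w.length by omega, Nat.add_mod_right,
        Nat.mod_eq_of_lt]
      omega
  have h2 : w.getVert ((i + 1) % w.length) = w.getVert (i + 1) := by
    by_cases h : i + 1 = w.length
    · rw [h, Nat.mod_self, Walk.getVert_zero, Walk.getVert_length]
    · rw [Nat.mod_eq_of_lt]; omega
  rw [h1, h2]

lemma sum_darts {V : Type*} {G : SimpleGraph V} {x y : V} (w : G.Walk x y) (F : V → V → ℕ) :
    (w.darts.map (fun d => F d.fst d.snd)).sum =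
      ∑ i ∈ Finset.range w.length, F (w.getVert i) (w.getVert (i + 1)) := by
  induction w with
  | nil => simp
  | cons h p ih =>
    rw [Walk.darts_cons, List.map_cons, List.sum_cons, ih, Walk.length_cons,
      Finset.sum_range_succ']
    simp only [Walk.getVert_cons_succ, Walk.getVert_zero]
    exact add_comm _ _

lemma traversals_eq {V : Type*} [DecidableEq V] {G : SimpleGraph V} {x y : V} (w : G.Walk x y)
    (a b : V) : traversals w a b =
      ∑ i ∈ Finset.range w.length, if w.getVert i = a ∧ w.getVert (i + 1) = b then 1 else 0 := by
  rw [← sum_darts w (fun p q => if p = a ∧ q = b then 1 else 0)]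
  unfold traversals
  induction w.darts with
  | nil => simp
  | cons d l ih =>
    rw [List.map_cons, List.count_cons, ih, List.map_cons, List.sum_cons, add_comm]
    congr 1
    simp [Prod.ext_iff]

lemma edges_count_eq {V : Type*} [DecidableEq V] {G : SimpleGraph V} {x y : V} (w : G.Walk x y)
    (e : Sym2 V) : w.edges.count e =
      ∑ i ∈ Finset.range w.length, if s(w.getVert i, w.getVert (i + 1)) = e then 1 else 0 := by
  rw [← sum_darts w (fun p q => if s(p, q) = e then 1 else 0)]
  unfold Walk.edges
  induction w.darts with
  | nil => simp
  | cons d l ih =>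
    rw [List.map_cons, List.count_cons, ih, List.map_cons, List.sum_cons, add_comm]
    congr 1
    simp [Dart.edge, Sym2.mk]

open Classical in
lemma parity {V : Type*} [Fintype V] [DecidableEq V]
    {G : SimpleGraph V} {x : V} (W : G.Walk x x) (hW : IsDoubleTrace W)
    (v : V) (M : Set V) (hM : M ⊆ G.neighborSet v) (i₀ : ℕ) (hi₀ : i₀ < W.length)
    (hv : W.getVert i₀ = v)
    (h : ∀ m < W.length, m ≠ i₀ → W.getVert m = v →
      (prv W.getVert W.length m ∈ M ↔ W.getVert (m + 1) ∈ M)) :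
    prv W.getVert W.length i₀ ∈ M ↔ W.getVert (i₀ + 1) ∈ M := by
  set n := W.length with hn
  set f := W.getVert with hf
  let A : ℕ → ℕ := fun i => if f i = v ∧ prv f n i ∈ M then 1 else 0
  let B : ℕ → ℕ := fun i => if f i = v ∧ f (i + 1) ∈ M then 1 else 0
  have h0n : f 0 = f n := by simp [hf, hn]
  have e1 : ∑ i ∈ Finset.range n, A (i + 1) = ∑ i ∈ Finset.range n, A i := by
    have a1 := Finset.sum_range_succ' A n
    have a2 := Finset.sum_range_succ A n
    have a3 : A n = A 0 := by
      simp only [A, prv, h0n]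
      have : n ≠ 0 := by omega
      simp [this]
    omega
  have hvM : v ∉ M := fun hh => G.loopless.irrefl v (hM hh)
  have e2 : ∑ i ∈ Finset.range n, (A (i + 1) + B i) =
      ∑ m ∈ Finset.univ.filter (· ∈ M), W.edges.count s(v, m) := by
    simp only [edges_count_eq]
    rw [Finset.sum_comm]
    refine Finset.sum_congr rfl fun i _ => ?_
    rw [Finset.sum_filter]
    simp only [A, B, prv, Nat.add_eq_zero_iff, one_ne_zero, and_false, if_false,
      Nat.add_sub_cancel]
    change _ = ∑ a, if a ∈ M then (if s(f i, f (i+1)) = s(v, a) then 1 else 0) else 0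
    by_cases c1 : f i = v
    · have c2 : f (i + 1) = v → f i ∉ M := fun _ => c1 ▸ hvM
      have : ∀ a, (if a ∈ M then (if s(f i, f (i+1)) = s(v, a) then 1 else 0) else 0)
          = if f (i+1) = a then (if f (i+1) ∈ M then 1 else 0) else 0 := by
        intro a
        by_cases ha : a ∈ M
        · have : v ≠ a := fun hh => hvM (hh ▸ ha)
          have : f i ≠ a := c1 ▸ this
          grind [Sym2.eq_iff]
        · grind
      simp only [this, Finset.sum_ite_eq, Finset.mem_univ, if_true]
      grind
    · have : ∀ a, (if a ∈ M then (if s(f i, f (i+1)) = s(v, a) then 1 else 0) else 0)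
          = if f i = a then (if f (i+1) = v ∧ f i ∈ M then 1 else 0) else 0 := by
        intro a
        grind [Sym2.eq_iff]
      simp only [this, Finset.sum_ite_eq, Finset.mem_univ, if_true]
      grind
  have e3 : 2 ∣ ∑ i ∈ Finset.range n, (A i + B i) := by
    rw [Finset.sum_add_distrib, ← e1, ← Finset.sum_add_distrib, e2]
    refine Finset.dvd_sum fun m hm => ?_
    rw [hW s(v, m) (hM (Finset.mem_filter.1 hm).2)]
  rw [← Finset.add_sum_erase _ _ (Finset.mem_range.2 hi₀)] at e3
  have e4 : 2 ∣ ∑ i ∈ (Finset.range n).erase i₀, (A i + B i) := by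
    refine Finset.dvd_sum fun m hm => ?_
    rw [Finset.mem_erase, Finset.mem_range] at hm
    have := h m hm.2 hm.1
    simp only [A, B]
    by_cases c : f m = v
    · have := this c
      by_cases d : f (m+1) ∈ M <;> simp [c, this, d]
    · simp [c]
  have e5 := (Nat.dvd_add_left e4).1 e3
  simp only [A, B, hv, true_and] at e5
  by_cases c : prv f n i₀ ∈ M <;> by_cases d : f (i₀ + 1) ∈ M <;> simp [c, d] at e5 ⊢

/-- Property of the rearranged walk. -/
def Rearr {V : Type*} {G : SimpleGraph V} {x : V} (W W' : G.Walk x x) (v : V) (i j k : ℕ) : Prop :=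
  W'.darts.Perm W.darts ∧ ∀ y N, HasRepetition W' y N ↔
    (∀ m < W.length, m ≠ i → m ≠ j → m ≠ k → W.getVert m = y →
      (prv W.getVert W.length m ∈ N ↔ W.getVert (m + 1) ∈ N)) ∧
    (v = y → (prv W.getVert W.length i ∈ N ↔ W.getVert (j + 1) ∈ N) ∧
      (prv W.getVert W.length j ∈ N ↔ W.getVert (k + 1) ∈ N) ∧
      (prv W.getVert W.length k ∈ N ↔ W.getVert (i + 1) ∈ N))

lemma Rearr.rot {V : Type*} {G : SimpleGraph V} {x : V} {W W' : G.Walk x x} {v : V} {i j k : ℕ}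
    (h : Rearr W W' v i j k) : Rearr W W' v j k i := by
  refine ⟨h.1, fun y N => (h.2 y N).trans ?_⟩
  constructor
  · rintro ⟨h1, h2⟩
    exact ⟨fun m hm a b c => h1 m hm c a b, fun hy => ⟨(h2 hy).2.1, (h2 hy).2.2, (h2 hy).1⟩⟩
  · rintro ⟨h1, h2⟩
    exact ⟨fun m hm a b c => h1 m hm b c a, fun hy => ⟨(h2 hy).2.2, (h2 hy).1, (h2 hy).2.1⟩⟩

/-- Swapping two consecutive closed pieces. -/
lemma exists_rearr_pieces {V : Type*} {G : SimpleGraph V} {x v : V} (P : G.Walk x v)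
    (S T : G.Walk v v) (R : G.Walk v x) (hS : 0 < S.length) (hT : 0 < T.length)
    (hR : 0 < R.length) :
    Rearr (P.append (S.append (T.append R))) (P.append (T.append (S.append R))) v
      P.length (P.length + S.length) (P.length + S.length + T.length) := by
  refine ⟨?_, fun y N => ?_⟩
  · simp only [Walk.darts_append]
    refine List.Perm.append_left _ ?_
    rw [← List.append_assoc, ← List.append_assoc]
    exact List.Perm.append_right _ List.perm_append_comm
  rw [hasRep_iff]
  set W := P.append (S.append (T.append R)) with hWd
  set W' := P.append (T.append (S.append R)) with hWd'
  set p := P.length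
  set s := S.length
  set t := T.length
  set r := R.length
  have l1 : W.length = p + s + t + r := by simp [hWd, p, s, t, r]; omega
  have l2 : W'.length = p + s + t + r := by simp [hWd', p, s, t, r]; omega
  have gv : v = W.getVert p := by simp [hWd, Walk.getVert_append, p]
  have g1 : ∀ m ≤ p, W'.getVert m = W.getVert m := by
    intro m hm
    simp only [hWd, hWd', Walk.getVert_append]
    by_cases h : m < P.length
    · simp only [if_pos h]
    · rw [if_neg h, if_neg h]
      have h0 : m - P.length = 0 := by omega
      have hS0 : 0 < S.length := hS
      have hT0 : 0 < T.length := hT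
      simp only [h0, hS0, hT0, if_true, Walk.getVert_zero]
  have g2 : ∀ m ≤ t, W'.getVert (p + m) = W.getVert (p + s + m) := by
    intro m hm
    simp only [hWd, hWd', Walk.getVert_append]
    have a1 : ¬ (p + m < P.length) := by omega
    have a2 : ¬ (p + s + m < P.length) := by omega
    have a3 : ¬ (p + s + m - P.length < S.length) := by omega
    have a4 : p + s + m - P.length - S.length = m := by omega
    have a5 : p + m - P.length = m := by omega
    rw [if_neg a1, if_neg a2, if_neg a3, a4, a5]
    by_cases h : m < T.length
    · simp only [if_pos h]
    · rw [if_neg h, if_neg h]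
      have h0 : m - T.length = 0 := by omega
      have hS0 : 0 < S.length := hS
      have hT0 : 0 < T.length := hT
      simp only [h0, hS0, hT0, if_true, Walk.getVert_zero]
  have g3 : ∀ m ≤ s, W'.getVert (p + t + m) = W.getVert (p + m) := by
    intro m hm
    simp only [hWd, hWd', Walk.getVert_append]
    have a1 : ¬ (p + m < P.length) := by omega
    have a2 : ¬ (p + t + m < P.length) := by omega
    have a3 : ¬ (p + t + m - P.length < T.length) := by omega
    have a4 : p + t + m - P.length - T.length = m := by omega
    have a5 : p + m - P.length = m := by omega
    rw [if_neg a1, if_neg a2, if_neg a3, a4, a5]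
    by_cases h : m < S.length
    · simp only [if_pos h]
    · rw [if_neg h, if_neg h]
      have h0 : m - S.length = 0 := by omega
      have hS0 : 0 < S.length := hS
      have hT0 : 0 < T.length := hT
      simp only [h0, hS0, hT0, if_true, Walk.getVert_zero]
  have g4 : ∀ m, p + s + t ≤ m → W'.getVert m = W.getVert m := by
    intro m hm
    simp only [hWd, hWd', Walk.getVert_append]
    have a1 : ¬ (m < P.length) := by omega
    have a2 : ¬ (m - P.length < S.length) := by omega
    have a3 : ¬ (m - P.length < T.length) := by omega
    have a4 : ¬ (m - P.length - S.length < T.length) := by omega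
    have a5 : ¬ (m - P.length - T.length < S.length) := by omega
    rw [if_neg a1, if_neg a2, if_neg a3, if_neg a4, if_neg a1, if_neg a5]
    congr 1; omega
  clear_value W W' p s t r
  rw [l1, l2]
  generalize W.getVert = f at *
  generalize W'.getVert = f' at *
  clear l1 l2 hWd hWd'
  have vt : f' (p + t) = v := by rw [gv]; exact g3 0 (by omega)
  have vp : f' p = v := by rw [gv]; exact g1 p le_rfl
  have vs : f' (p + s + t) = v := by
    rw [gv, ← g1 p le_rfl]; have := g3 s le_rfl; have h2 := g2 0 (by omega)
    simp only [add_zero] at h2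
    rw [h2, ← this]; congr 1; omega
  -- predecessor facts
  have q1 : prv f' (p + s + t + r) p = prv f (p + s + t + r) p := by
    unfold prv; split_ifs
    · exact g4 _ (by omega)
    · exact g1 _ (by omega)
  have q2 : prv f' (p + s + t + r) (p + t) = prv f (p + s + t + r) (p + s + t) := by
    unfold prv; rw [if_neg (by omega), if_neg (by omega)]
    have := g2 (t - 1) (by omega)
    convert this using 2 <;> omega
  have q3 : prv f' (p + s + t + r) (p + s + t) = prv f (p + s + t + r) (p + s) := by
    unfold prv; rw [if_neg (by omega), if_neg (by omega)]
    have := g3 (s - 1) (by omega)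
    convert this using 2 <;> omega
  have u1 : f' (p + 1) = f (p + s + 1) := g2 1 (by omega)
  have u2 : f' (p + t + 1) = f (p + 1) := g3 1 (by omega)
  have u3 : f' (p + s + t + 1) = f (p + s + t + 1) := g4 _ (by omega)
  -- generic positions
  have w1 : ∀ m, m < p ∨ p + s + t < m → f' m = f m ∧
      prv f' (p + s + t + r) m = prv f (p + s + t + r) m ∧ f' (m + 1) = f (m + 1) := by
    rintro m (hm | hm)
    · refine ⟨g1 _ (by omega), ?_, g1 _ (by omega)⟩
      unfold prv; split_ifs
      · exact g4 _ (by omega)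
      · exact g1 _ (by omega)
    · refine ⟨g4 _ (by omega), ?_, g4 _ (by omega)⟩
      unfold prv; rw [if_neg (by omega)]
      exact g4 _ (by omega)
  have w2 : ∀ m, 0 < m → m < t → f' (p + m) = f (p + s + m) ∧
      prv f' (p + s + t + r) (p + m) = prv f (p + s + t + r) (p + s + m) ∧
      f' (p + m + 1) = f (p + s + m + 1) := by
    intro m h0 hm
    refine ⟨g2 _ (by omega), ?_, g2 (m + 1) (by omega)⟩
    unfold prv; rw [if_neg (by omega), if_neg (by omega)]
    have := g2 (m - 1) (by omega)
    convert this using 2 <;> omega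
  have w3 : ∀ m, 0 < m → m < s → f' (p + t + m) = f (p + m) ∧
      prv f' (p + s + t + r) (p + t + m) = prv f (p + s + t + r) (p + m) ∧
      f' (p + t + m + 1) = f (p + m + 1) := by
    intro m h0 hm
    refine ⟨g3 _ (by omega), ?_, g3 (m + 1) (by omega)⟩
    unfold prv; rw [if_neg (by omega), if_neg (by omega)]
    have := g3 (m - 1) (by omega)
    convert this using 2 <;> omega
  clear g1 g2 g3 g4
  constructor
  · intro H
    refine ⟨fun m hm n1 n2 n3 hy => ?_, fun hy => ⟨?_, ?_, ?_⟩⟩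
    · by_cases c1 : m < p ∨ p + s + t < m
      · obtain ⟨a1, a2, a3⟩ := w1 m c1
        rw [← a2, ← a3]; exact H m hm (a1.trans hy)
      · by_cases c2 : m < p + s
        · obtain ⟨a1, a2, a3⟩ := w3 (m - p) (by omega) (by omega)
          rw [show p + (m - p) = m by omega] at a1 a2 a3
          rw [← a2, ← a3]; exact H _ (by omega) (a1.trans hy)
        · obtain ⟨a1, a2, a3⟩ := w2 (m - (p + s)) (by omega) (by omega)
          rw [show p + s + (m - (p + s)) = m by omega] at a1 a2 a3
          rw [← a2, ← a3]; exact H _ (by omega) (a1.trans hy)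
    · rw [← q1, ← u1]; exact H _ (by omega) (vp.trans hy)
    · rw [← q3, ← u3]; exact H _ (by omega) (vs.trans hy)
    · rw [← q2, ← u2]; exact H _ (by omega) (vt.trans hy)
  · rintro ⟨H, K⟩ m hm hy
    by_cases c1 : m < p ∨ p + s + t < m
    · obtain ⟨a1, a2, a3⟩ := w1 m c1
      rw [a2, a3]; exact H m hm (by omega) (by omega) (by omega) (a1.symm.trans hy)
    · by_cases d1 : m = p
      · subst d1; rw [q1, u1]; exact (K (vp.symm.trans hy)).1
      by_cases d2 : m = p + t
      · subst d2; rw [q2, u2]; exact (K (vt.symm.trans hy)).2.2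
      by_cases d3 : m = p + s + t
      · subst d3; rw [q3, u3]; exact (K (vs.symm.trans hy)).2.1
      by_cases c2 : m < p + t
      · obtain ⟨a1, a2, a3⟩ := w2 (m - p) (by omega) (by omega)
        rw [show p + (m - p) = m by omega] at a1 a2 a3
        rw [a2, a3]
        exact H _ (by omega) (by omega) (by omega) (by omega) (a1.symm.trans hy)
      · obtain ⟨a1, a2, a3⟩ := w3 (m - (p + t)) (by omega) (by omega)
        rw [show p + t + (m - (p + t)) = m by omega] at a1 a2 a3
        rw [a2, a3]
        exact H _ (by omega) (by omega) (by omega) (by omega) (a1.symm.trans hy)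

lemma split_walk {V : Type*} {G : SimpleGraph V} {x y v : V} (W : G.Walk x y) (a : ℕ)
    (ha : a ≤ W.length) (hv : W.getVert a = v) :
    ∃ (P : G.Walk x v) (Q : G.Walk v y), W = P.append Q ∧ P.length = a := by
  subst hv
  exact ⟨W.take a, W.drop a, by simp, by simp [Walk.take_length, ha]⟩

lemma exists_rearr {V : Type*} {G : SimpleGraph V} {x v : V} (W : G.Walk x x) (a b c : ℕ)
    (hab : a < b) (hbc : b < c) (hc : c < W.length) (ha' : W.getVert a = v)
    (hb' : W.getVert b = v) (hc' : W.getVert c = v) : ∃ W', Rearr W W' v a b c := by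
  obtain ⟨P, Q, rfl, hP⟩ := split_walk W a (by omega) ha'
  rw [Walk.length_append] at hc
  rw [Walk.getVert_append, if_neg (by omega)] at hb' hc'
  obtain ⟨S, Q, rfl, hS⟩ := split_walk Q (b - P.length) (by omega) hb'
  rw [Walk.length_append] at hc
  rw [Walk.getVert_append, if_neg (by omega)] at hc'
  obtain ⟨T, R, rfl, hT⟩ := split_walk Q _ (by omega) hc'
  rw [Walk.length_append] at hc
  have := exists_rearr_pieces P S T R (by omega) (by omega) (by omega)
  have hb2 : P.length + S.length = b := by omega
  have hc2 : P.length + S.length + T.length = c := by omega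
  rw [hc2, hb2, hP] at this
  exact ⟨_, this⟩

lemma core {V : Type*} [Fintype V] [DecidableEq V]
    {G : SimpleGraph V} {x : V} (W : G.Walk x x) (hW : IsDoubleTrace W)
    (v : V) (N₁ N₂ : Set V)
    (hN₁ : N₁ ⊆ G.neighborSet v)
    (hdisj : Disjoint N₁ N₂)
    (hN₁ne : N₁.Nonempty) (hN₁pr : N₁ ≠ G.neighborSet v)
    (hrep₁ : HasRepetition W v N₁) (hrep₂ : HasRepetition W v N₂)
    (i j k : ℕ) (hi : i < W.length) (hj : j < W.length) (hk : k < W.length)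
    (hvi : W.getVert i = v) (hvj : W.getVert j = v) (hvk : W.getVert k = v)
    (h1j : prv W.getVert W.length j ∈ N₁)
    (h2k : W.getVert (k + 1) ∈ N₂)
    (hsame : prv W.getVert W.length i = prv W.getVert W.length j ∨
      W.getVert (i + 1) = W.getVert (j + 1))
    (W' : G.Walk x x) (hr : Rearr W W' v i j k) :
    ∃ (x' : V) (W' : G.Walk x' x'), IsDoubleTrace W' ∧
      (∀ a b, G.Adj a b → traversals W' a b = traversals W a b) ∧
      {N : Set V | N ⊆ G.neighborSet v ∧ N.Nonempty ∧ N ≠ G.neighborSet v ∧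
          HasRepetition W' v N}.ncard <
        {N : Set V | N ⊆ G.neighborSet v ∧ N.Nonempty ∧ N ≠ G.neighborSet v ∧
          HasRepetition W v N}.ncard ∧
      {p : V × Set V | p.2 ⊆ G.neighborSet p.1 ∧ p.2.Nonempty ∧ p.2 ≠ G.neighborSet p.1 ∧
          HasRepetition W' p.1 p.2}.ncard <
        {p : V × Set V | p.2 ⊆ G.neighborSet p.1 ∧ p.2.Nonempty ∧ p.2 ≠ G.neighborSet p.1 ∧
          HasRepetition W p.1 p.2}.ncard := by
  have hsub : ∀ y N, HasRepetition W' y N → HasRepetition W y N := by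
    intro y N hN
    obtain ⟨H, K⟩ := (hr.2 y N).1 hN
    rw [hasRep_iff]
    by_cases hy : v = y
    swap
    · intro m hm hmy
      refine H m hm ?_ ?_ ?_ hmy <;> rintro rfl <;> exact hy (by rw [← hmy]; symm; assumption)
    subst hy
    obtain ⟨K1, K2, K3⟩ := K rfl
    have r1 := (hasRep_iff W v N₁).1 hrep₁
    have r2 := (hasRep_iff W v N₂).1 hrep₂
    have nd : ∀ z, z ∈ N₂ → z ∉ N₁ := fun z h2 h1 => Set.disjoint_left.1 hdisj h1 h2
    have h2k' := (r2 k hk hvk).2 h2k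
    have h1j' := (r1 j hj hvj).1 h1j
    have r1i := r1 i hi hvi
    have gen : ∀ m < W.length, m ≠ i → m ≠ j → W.getVert m = v →
        (prv W.getVert W.length m ∈ N ∩ N₁ ↔ W.getVert (m + 1) ∈ N ∩ N₁) := by
      intro m hm m1 m2 hmv
      by_cases m3 : m = k
      · subst m3
        exact ⟨fun h => absurd h.2 (nd _ h2k'), fun h => absurd h.2 (nd _ h2k)⟩
      · exact and_congr (H m hm m1 m2 m3 hmv) (r1 m hm hmv)
    have par := parity W hW v (N ∩ N₁) (fun z hz => hN₁ hz.2)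
    have hij : (prv W.getVert W.length i ∈ N ↔ W.getVert (i + 1) ∈ N) ∧
        (prv W.getVert W.length j ∈ N ↔ W.getVert (j + 1) ∈ N) := by
      rcases hsame with hs | hs
      · have cj : prv W.getVert W.length j ∈ N ↔ W.getVert (j + 1) ∈ N := by rw [← hs]; exact K1
        refine ⟨?_, cj⟩
        have h1i : prv W.getVert W.length i ∈ N₁ := hs ▸ h1j
        have h1i' := r1i.1 h1i
        have := par i hi hvi (fun m hm hmi hmv => by
          by_cases m2 : m = j
          · subst m2; exact and_congr cj (r1 m hm hmv)
          · exact gen m hm hmi m2 hmv)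
        simpa [h1i, h1i'] using this
      · have ci : prv W.getVert W.length i ∈ N ↔ W.getVert (i + 1) ∈ N := by rw [hs]; exact K1
        refine ⟨ci, ?_⟩
        have := par j hj hvj (fun m hm hmj hmv => by
          by_cases m2 : m = i
          · subst m2; exact and_congr ci (r1 m hm hmv)
          · exact gen m hm m2 hmj hmv)
        simpa [h1j, h1j'] using this
    intro m hm hmv
    by_cases m1 : m = i
    · subst m1; exact hij.1
    by_cases m2 : m = j
    · subst m2; exact hij.2
    by_cases m3 : m = k
    · subst m3; exact K3.trans (hij.1.symm.trans (K1.trans (hij.2.symm.trans K2)))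
    exact H m hm m1 m2 m3 hmv
  have hnot : ¬ HasRepetition W' v N₁ := by
    intro hN
    have := ((hr.2 v N₁).1 hN).2 rfl
    exact Set.disjoint_left.1 hdisj (this.2.1.1 h1j) h2k
  refine ⟨x, W', ?_, ?_, ?_, ?_⟩
  · intro e he
    rw [← hW e he]
    exact (hr.1.map _).count_eq e
  · intro a b _
    exact (hr.1.map _).count_eq _
  · refine Set.ncard_lt_ncard ?_ (Set.toFinite _)
    refine ⟨fun N hN => ⟨hN.1, hN.2.1, hN.2.2.1, hsub _ _ hN.2.2.2⟩, fun hh => hnot ?_⟩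
    exact (hh (a := N₁) ⟨hN₁, hN₁ne, hN₁pr, hrep₁⟩).2.2.2
  · refine Set.ncard_lt_ncard ?_ (Set.toFinite _)
    refine ⟨fun N hN => ⟨hN.1, hN.2.1, hN.2.2.1, hsub _ _ hN.2.2.2⟩, fun hh => hnot ?_⟩
    exact (hh (a := (v, N₁)) ⟨hN₁, hN₁ne, hN₁pr, hrep₁⟩).2.2.2

/-- Every traversed dart into `v` gives a visit. -/
lemma visit_of_in {V : Type*} {G : SimpleGraph V} {x : V} (W : G.Walk x x) (i : ℕ)
    (hi : i < W.length) : ∃ j < W.length, W.getVert j = W.getVert (i + 1) ∧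
      prv W.getVert W.length j = W.getVert i ∧ (j = i + 1 ∨ (j = 0 ∧ i + 1 = W.length)) := by
  by_cases h : i + 1 = W.length
  · refine ⟨0, by omega, by rw [h]; simp, ?_, Or.inr ⟨rfl, h⟩⟩
    unfold prv; rw [if_pos rfl]; congr 1; omega
  · exact ⟨i + 1, by omega, rfl, by simp [prv], Or.inl rfl⟩

lemma two_of_traversals {V : Type*} [DecidableEq V] {G : SimpleGraph V} {x y : V}
    (w : G.Walk x y) (a b : V) (h : traversals w a b = 2) :
    ∃ i < w.length, ∃ j < w.length, i ≠ j ∧ (w.getVert i = a ∧ w.getVert (i + 1) = b) ∧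
      (w.getVert j = a ∧ w.getVert (j + 1) = b) := by
  rw [traversals_eq, ← Finset.card_filter] at h
  obtain ⟨i, hi, j, hj, hij⟩ := Finset.one_lt_card.1 (h.symm ▸ one_lt_two)
  simp only [Finset.mem_filter, Finset.mem_range] at hi hj
  exact ⟨i, hi.1, j, hj.1, hij, hi.2, hj.2⟩

/-- If a double trace `W` has two disjoint nontrivial repetitions at a vertex `v`, and some
edge `uv` with `u` in the first repetition set is traversed twice in the same direction, then
there is a double trace `W'` preserving all directed traversal counts of `W` which has strictly
fewer nontrivial repetition sets at `v`, and strictly fewer nontrivial repetition sets in total. -/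
theorem reduce_nontrivial_repetitions {V : Type*} [Fintype V] [DecidableEq V]
    {G : SimpleGraph V} {x : V} (W : G.Walk x x) (hW : IsDoubleTrace W)
    (v : V) (N₁ N₂ : Set V)
    (hN₁ : N₁ ⊆ G.neighborSet v) (hN₂ : N₂ ⊆ G.neighborSet v)
    (hdisj : Disjoint N₁ N₂)
    (hN₁ne : N₁.Nonempty) (hN₁pr : N₁ ≠ G.neighborSet v)
    (hN₂ne : N₂.Nonempty) (hN₂pr : N₂ ≠ G.neighborSet v)
    (hrep₁ : HasRepetition W v N₁) (hrep₂ : HasRepetition W v N₂)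
    (u : V) (hu : u ∈ N₁) (huv : G.Adj u v)
    (hsame : traversals W u v = 2 ∨ traversals W v u = 2) :
    ∃ (x' : V) (W' : G.Walk x' x'), IsDoubleTrace W' ∧
      (∀ a b, G.Adj a b → traversals W' a b = traversals W a b) ∧
      {N : Set V | N ⊆ G.neighborSet v ∧ N.Nonempty ∧ N ≠ G.neighborSet v ∧
          HasRepetition W' v N}.ncard <
        {N : Set V | N ⊆ G.neighborSet v ∧ N.Nonempty ∧ N ≠ G.neighborSet v ∧
          HasRepetition W v N}.ncard ∧
      {p : V × Set V | p.2 ⊆ G.neighborSet p.1 ∧ p.2.Nonempty ∧ p.2 ≠ G.neighborSet p.1 ∧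
          HasRepetition W' p.1 p.2}.ncard <
        {p : V × Set V | p.2 ⊆ G.neighborSet p.1 ∧ p.2.Nonempty ∧ p.2 ≠ G.neighborSet p.1 ∧
          HasRepetition W p.1 p.2}.ncard := by
  have hk : ∃ k < W.length, W.getVert k = v ∧ W.getVert (k + 1) ∈ N₂ := by
    obtain ⟨b, hb⟩ := hN₂ne
    have hc := hW s(v, b) (hN₂ hb)
    rw [edges_count_eq] at hc
    obtain ⟨i, hi, hi'⟩ := Finset.exists_ne_zero_of_sum_ne_zero (by rw [hc]; norm_num)
    rw [Finset.mem_range] at hi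
    have he : s(W.getVert i, W.getVert (i + 1)) = s(v, b) := by
      by_contra hne
      exact hi' (if_neg hne)
    rcases Sym2.eq_iff.1 he with ⟨h1, h2⟩ | ⟨h1, h2⟩
    · exact ⟨i, hi, h1, h2 ▸ hb⟩
    · obtain ⟨j, hj, j1, j2, -⟩ := visit_of_in W i hi
      have hjv := j1.trans h2
      exact ⟨j, hj, hjv, ((hasRep_iff W v N₂).1 hrep₂ j hj hjv).1 (by rw [j2, h1]; exact hb)⟩
  have hij : ∃ i < W.length, ∃ j < W.length, i ≠ j ∧ W.getVert i = v ∧ W.getVert j = v ∧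
      prv W.getVert W.length i ∈ N₁ ∧ prv W.getVert W.length j ∈ N₁ ∧
      (prv W.getVert W.length i = prv W.getVert W.length j ∨
        W.getVert (i + 1) = W.getVert (j + 1)) := by
    rcases hsame with h | h
    · obtain ⟨i, hi, j, hj, hne, ⟨i1, i2⟩, j1, j2⟩ := two_of_traversals W u v h
      obtain ⟨i', hi', a1, a2, a3⟩ := visit_of_in W i hi
      obtain ⟨j', hj', b1, b2, b3⟩ := visit_of_in W j hj
      refine ⟨i', hi', j', hj', by omega, a1.trans i2, b1.trans j2, ?_, ?_, Or.inl ?_⟩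
      · rw [a2, i1]; exact hu
      · rw [b2, j1]; exact hu
      · rw [a2, b2, i1, j1]
    · obtain ⟨i, hi, j, hj, hne, ⟨i1, i2⟩, j1, j2⟩ := two_of_traversals W v u h
      have r1 := (hasRep_iff W v N₁).1 hrep₁
      refine ⟨i, hi, j, hj, hne, i1, j1, (r1 i hi i1).2 (i2 ▸ hu), (r1 j hj j1).2 (j2 ▸ hu),
        Or.inr (i2.trans j2.symm)⟩
  obtain ⟨k, hk, kv, k2⟩ := hk
  obtain ⟨i, hi, j, hj, hne, iv, jv, i1, j1, hs⟩ := hij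
  have r2 := (hasRep_iff W v N₂).1 hrep₂ k hk kv
  have hki : k ≠ i := by
    rintro rfl
    exact Set.disjoint_left.1 hdisj i1 (r2.2 k2)
  have hkj : k ≠ j := by
    rintro rfl
    exact Set.disjoint_left.1 hdisj j1 (r2.2 k2)
  have main : (∃ W', Rearr W W' v i j k) ∨ (∃ W', Rearr W W' v j i k) := by
    rcases lt_or_gt_of_ne hne with h1 | h1 <;> rcases lt_or_gt_of_ne hki with h2 | h2 <;>
      rcases lt_or_gt_of_ne hkj with h3 | h3
    · obtain ⟨W', h⟩ := exists_rearr W k i j h2 h1 hj kv iv jv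
      exact Or.inl ⟨W', h.rot⟩
    · omega
    · obtain ⟨W', h⟩ := exists_rearr W i k j h2 h3 hj iv kv jv
      exact Or.inr ⟨W', h.rot.rot⟩
    · obtain ⟨W', h⟩ := exists_rearr W i j k h1 h3 hk iv jv kv
      exact Or.inl ⟨W', h⟩
    · obtain ⟨W', h⟩ := exists_rearr W k j i h3 h1 hi kv jv iv
      exact Or.inr ⟨W', h.rot⟩
    · obtain ⟨W', h⟩ := exists_rearr W j k i h3 h2 hi jv kv iv
      exact Or.inl ⟨W', h.rot.rot⟩
    · omega
    · obtain ⟨W', h⟩ := exists_rearr W j i k h1 h2 hk jv iv kv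
      exact Or.inr ⟨W', h⟩
  rcases main with ⟨W', h⟩ | ⟨W', h⟩
  · exact core W hW v N₁ N₂ hN₁ hdisj hN₁ne hN₁pr hrep₁ hrep₂ i j k hi hj hk iv jv kv j1 k2 hs W' h
  · exact core W hW v N₁ N₂ hN₁ hdisj hN₁ne hN₁pr hrep₁ hrep₂ j i k hj hi hk jv iv kv i1 k2
      (hs.imp Eq.symm Eq.symm) W' h
end
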